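/- Let S : [0,∞) × Lip → Lip satisfy: (H1) S(0,u_0) = u_0 and S(t+s,u_0) = S(t,S(s,u_0)) for all s,t ≥ 0, and (t,u_0) ↦ S(t,u_0) is continuous for the topology of local uniform convergence; (H2) for all bounded u_0^1, u_0^2 ∈ Lip and all t ≥ 0, sup_ℝ |S(t,u_0^1) − S(t,u_0^2)| ≤ sup_ℝ |u_0^1 − u_0^2|; (H3) S(t, u_0 + c) = S(t,u_0) + c for every constant c ∈ ℝ and every u_0 ∈ Lip; (H4) there exists C_0 > 0 such that if u_0^1 = u_0^2 on [a,b] then S(t,u_0^1) = S(t,u_0^2) on [a + C_0 t, b − C_0 t] for all t ∈ [0, C_0^{-1}(b−a)]; (H5) for every u_0 ∈ Lip, every x ≠ 0, every t ∈ (0, C_0^{-1}|x|) and every y with |y − x| < |x| − C_0 t, one has S(t,u_0)(y) = ū(t,y) whenever ū is a flux-limited viscosity solution with flux limiter A_max and initial datum u_0; (H6) ε S(t/ε, ε u_0(·/ε))(x/ε) = S(t,u_0)(x) for all ε, t > 0, all x ∈ ℝ and all u_0 ∈ Lip. Then there exists Ā ∈ [0, A_max] such that for every u_0 ∈ Lip,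 the function (t,x) ↦ S(t,u_0)(x) is a flux-limited viscosity solution with flux limiter Ā and initial datum u_0. -/

import Mathlib

open Set Filter MeasureTheory Topology

noncomputable section

/-- The class `Lip`: Lipschitz functions with `u' ∈ [0,Rl]` a.e. on `(-∞,0)` and
`u' ∈ [0,Rr]` a.e. on `(0,∞)`, expressed through difference quotients. -/
def LipClass (Rl Rr : ℝ) (u : ℝ → ℝ) : Prop :=
  (∀ x y : ℝ, x ≤ y → y ≤ 0 → 0 ≤ u y - u x ∧ u y - u x ≤ Rl * (y - x)) ∧
  (∀ x y : ℝ, 0 ≤ x → x ≤ y → 0 ≤ u y - u x ∧ u y - u x ≤ Rr * (y - x))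

/-- The discontinuous Hamiltonian `H(x,p)`. -/
def Hx (Hl Hr : ℝ → ℝ) (x p : ℝ) : ℝ := if x < 0 then Hl p else Hr p

/-- `A_max = min{max_{[0,Rl]} Hl, max_{[0,Rr]} Hr}`. -/
def Amax (Hl Hr : ℝ → ℝ) (Rl Rr : ℝ) : ℝ :=
  min (sSup (Hl '' Icc 0 Rl)) (sSup (Hr '' Icc 0 Rr))

/-- `(H^l)^+(p) = sup_{0 ≤ y ≤ p} H^l(y)`. -/
def Hplus (Hl : ℝ → ℝ) (p : ℝ) : ℝ := sSup (Hl '' Icc 0 p)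

/-- `(H^r)^-(p) = sup_{p ≤ y ≤ Rr} H^r(y)`. -/
def Hminus (Hr : ℝ → ℝ) (Rr p : ℝ) : ℝ := sSup (Hr '' Icc p Rr)

/-- `p_A^{·,-}`: the smallest solution in `[0,R]` of `Hf p = A`. -/
def pm (Hf : ℝ → ℝ) (R A : ℝ) : ℝ := sInf {p ∈ Icc 0 R | Hf p = A}

/-- `p_A^{·,+}`: the largest solution in `[0,R]` of `Hf p = A`. -/
def pp (Hf : ℝ → ℝ) (R A : ℝ) : ℝ := sSup {p ∈ Icc 0 R | Hf p = A}

/-- `φ̂_A`. -/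
def phiHat (Hl Hr : ℝ → ℝ) (Rl Rr A x : ℝ) : ℝ :=
  if x ≤ 0 then pp Hl Rl A * x else pm Hr Rr A * x

/-- `φ̌_A`. -/
def phiCheck (Hl Hr : ℝ → ℝ) (Rl Rr A x : ℝ) : ℝ :=
  if x ≤ 0 then pm Hl Rl A * x else pp Hr Rr A * x

/-- A junction test function, given by a pair (φl, φr) of C¹ functions agreeing at `x = 0`. -/
def JTF (φl φr : ℝ → ℝ → ℝ) : Prop :=
  ContDiff ℝ 1 (fun p : ℝ × ℝ => φl p.1 p.2) ∧
  ContDiff ℝ 1 (fun p : ℝ × ℝ => φr p.1 p.2) ∧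
  ∀ t, φl t 0 = φr t 0

/-- The glued junction test function. -/
def glue (φl φr : ℝ → ℝ → ℝ) (t x : ℝ) : ℝ := if x ≤ 0 then φl t x else φr t x

/-- The time-space domain `[0,∞) × ℝ`. -/
def domHJ : Set (ℝ × ℝ) := Ici (0 : ℝ) ×ˢ (univ : Set ℝ)

/-- Flux-limited viscosity solution with flux limiter `A` and initial datum `u0`. -/
def FLSol (Hl Hr : ℝ → ℝ) (Rl Rr A : ℝ) (u0 : ℝ → ℝ) (u : ℝ → ℝ → ℝ) : Prop :=
  ContinuousOn (fun p : ℝ × ℝ => u p.1 p.2) domHJ ∧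
  (∀ t : ℝ, 0 ≤ t → LipClass Rl Rr (u t)) ∧
  (∀ x, u 0 x = u0 x) ∧
  (∀ φl φr : ℝ → ℝ → ℝ, JTF φl φr →
    ∀ t x : ℝ, 0 < t →
      IsLocalMaxOn (fun p : ℝ × ℝ => u p.1 p.2 - glue φl φr p.1 p.2) domHJ (t, x) →
      (x < 0 → deriv (fun s => φl s x) t + Hl (deriv (φl t) x) ≤ 0) ∧
      (0 < x → deriv (fun s => φr s x) t + Hr (deriv (φr t) x) ≤ 0) ∧
      (x = 0 → deriv (fun s => φl s 0) t +
        min A (min (Hplus Hl (deriv (φl t) 0)) (Hminus Hr Rr (deriv (φr t) 0))) ≤ 0)) ∧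
  (∀ φl φr : ℝ → ℝ → ℝ, JTF φl φr →
    ∀ t x : ℝ, 0 < t →
      IsLocalMinOn (fun p : ℝ × ℝ => u p.1 p.2 - glue φl φr p.1 p.2) domHJ (t, x) →
      (x < 0 → 0 ≤ deriv (fun s => φl s x) t + Hl (deriv (φl t) x)) ∧
      (0 < x → 0 ≤ deriv (fun s => φr s x) t + Hr (deriv (φr t) x)) ∧
      (x = 0 → 0 ≤ deriv (fun s => φl s 0) t +
        min A (min (Hplus Hl (deriv (φl t) 0)) (Hminus Hr Rr (deriv (φr t) 0)))))

/-- Viscosity solution of `∂_t u + H(x, ∂_x u) = 0` on `(0,∞) × (ℝ \ {0})`. -/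
def ViscSolOff (Hl Hr : ℝ → ℝ) (u : ℝ → ℝ → ℝ) : Prop :=
  ∀ φ : ℝ → ℝ → ℝ, ContDiff ℝ 1 (fun p : ℝ × ℝ => φ p.1 p.2) →
    ∀ t x : ℝ, 0 < t → x ≠ 0 →
      (IsLocalMaxOn (fun p : ℝ × ℝ => u p.1 p.2 - φ p.1 p.2) domHJ (t, x) →
        deriv (fun s => φ s x) t + Hx Hl Hr x (deriv (φ t) x) ≤ 0) ∧
      (IsLocalMinOn (fun p : ℝ × ℝ => u p.1 p.2 - φ p.1 p.2) domHJ (t, x) →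
        0 ≤ deriv (fun s => φ s x) t + Hx Hl Hr x (deriv (φ t) x))

/-! ### The class `Lip` -/

/-- The continuous function with slope `p` on the left of the origin and `q` on the right. -/
def pwLin (p q x : ℝ) : ℝ := if x ≤ 0 then p * x else q * x

lemma pwLin_of_nonpos {p q x : ℝ} (hx : x ≤ 0) : pwLin p q x = p * x := if_pos hx

lemma pwLin_of_nonneg {p q x : ℝ} (hx : 0 ≤ x) : pwLin p q x = q * x := by
  rcases hx.eq_or_lt with rfl | hx
  · simp [pwLin]
  · exact if_neg (not_le.2 hx)

@[simp] lemma pwLin_zero (p q : ℝ) : pwLin p q 0 = 0 := by simp [pwLin]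

lemma pwLin_smul {p q ε : ℝ} (hε : 0 < ε) (y : ℝ) : ε * pwLin p q (y / ε) = pwLin p q y := by
  rcases le_total y 0 with hy | hy
  · rw [pwLin_of_nonpos hy, pwLin_of_nonpos (div_nonpos_of_nonpos_of_nonneg hy hε.le)]
    field_simp
  · rw [pwLin_of_nonneg hy, pwLin_of_nonneg (div_nonneg hy hε.le)]
    field_simp

lemma lipClass_pwLin {Rl Rr p q : ℝ} (hp : p ∈ Icc 0 Rl) (hq : q ∈ Icc 0 Rr) :
    LipClass Rl Rr (pwLin p q) := by
  refine ⟨fun x y hxy hy => ?_, fun x y hx hxy => ?_⟩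
  · rw [pwLin_of_nonpos hy, pwLin_of_nonpos (hxy.trans hy)]
    constructor <;> nlinarith [hp.1, hp.2]
  · rw [pwLin_of_nonneg hx, pwLin_of_nonneg (hx.trans hxy)]
    constructor <;> nlinarith [hq.1, hq.2]

/-- Increasing slopes on the left and decreasing them on the right lowers `pwLin`. -/
lemma pwLin_le_pwLin {p q p' q' : ℝ} (hp : p ≤ p') (hq : q' ≤ q) (x : ℝ) :
    pwLin p' q' x ≤ pwLin p q x := by
  rcases le_total x 0 with hx | hx
  · rw [pwLin_of_nonpos hx, pwLin_of_nonpos hx]; nlinarith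
  · rw [pwLin_of_nonneg hx, pwLin_of_nonneg hx]; nlinarith

namespace LipClass

variable {Rl Rr : ℝ} {u : ℝ → ℝ}

lemma monotone (hu : LipClass Rl Rr u) : Monotone u := by
  intro x y hxy
  rcases le_total y 0 with hy | hy
  · linarith [(hu.1 x y hxy hy).1]
  · rcases le_total x 0 with hx | hx
    · linarith [(hu.1 x 0 hx le_rfl).1, (hu.2 0 y le_rfl hy).1]
    · linarith [(hu.2 x y hx hxy).1]

lemma sub_le (hu : LipClass Rl Rr u) {x y : ℝ} (hxy : x ≤ y) :
    u y - u x ≤ max Rl Rr * (y - x) := by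
  have hl := le_max_left Rl Rr
  have hr := le_max_right Rl Rr
  rcases le_total y 0 with hy | hy
  · nlinarith [(hu.1 x y hxy hy).2]
  · rcases le_total x 0 with hx | hx
    · nlinarith [(hu.1 x 0 hx le_rfl).2, (hu.2 0 y le_rfl hy).2]
    · nlinarith [(hu.2 x y hx hxy).2]

lemma continuous (hu : LipClass Rl Rr u) : Continuous u := by
  refine (LipschitzWith.of_dist_le' (K := max Rl Rr) fun x y => ?_).continuous
  rw [Real.dist_eq, Real.dist_eq]
  rcases le_total x y with h | h
  · rw [abs_sub_comm, abs_of_nonneg (sub_nonneg.2 (hu.monotone h)), abs_sub_comm x y,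
      abs_of_nonneg (sub_nonneg.2 h)]
    exact hu.sub_le h
  · rw [abs_of_nonneg (sub_nonneg.2 (hu.monotone h)), abs_of_nonneg (sub_nonneg.2 h)]
    exact hu.sub_le h

lemma add_const (hu : LipClass Rl Rr u) (c : ℝ) : LipClass Rl Rr (fun y => u y + c) := by
  refine ⟨fun x y hxy hy => ?_, fun x y hx hxy => ?_⟩
  · simpa using hu.1 x y hxy hy
  · simpa using hu.2 x y hx hxy

/-- Freezing a function of the class outside `[a, b]` stays in the class. -/
lemma clamp (hRl : 0 ≤ Rl) (hRr : 0 ≤ Rr) (hu : LipClass Rl Rr u) {a b : ℝ} (hab : a ≤ b) :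
    LipClass Rl Rr (fun y => u (max a (min b y))) := by
  have key : ∀ x y : ℝ, x ≤ y → max a (min b x) ≤ max a (min b y) ∧
      max a (min b y) - max a (min b x) ≤ y - x := by
    intro x y hxy
    refine ⟨max_le_max le_rfl (min_le_min le_rfl hxy), ?_⟩
    grind
  refine ⟨fun x y hxy hy => ?_, fun x y hx hxy => ?_⟩
  · rcases le_or_gt a 0 with ha | ha
    · have h := hu.1 _ _ (key x y hxy).1 (max_le ha ((min_le_right _ _).trans hy))
      exact ⟨h.1, h.2.trans (mul_le_mul_of_nonneg_left (key x y hxy).2 hRl)⟩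
    · have hx' : max a (min b x) = a := max_eq_left ((min_le_right _ _).trans (by linarith))
      have hy' : max a (min b y) = a := max_eq_left ((min_le_right _ _).trans (by linarith))
      simp only [hx', hy', sub_self]
      exact ⟨le_rfl, mul_nonneg hRl (by linarith)⟩
  · rcases le_or_gt 0 b with hb | hb
    · have h := hu.2 _ _ (le_max_of_le_right (le_min hb hx)) (key x y hxy).1
      exact ⟨h.1, h.2.trans (mul_le_mul_of_nonneg_left (key x y hxy).2 hRr)⟩
    · have hx' : max a (min b x) = b := by
        rw [min_eq_left (by linarith), max_eq_right hab]
      have hy' : max a (min b y) = b := by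
        rw [min_eq_left (by linarith), max_eq_right hab]
      simp only [hx', hy', sub_self]
      exact ⟨le_rfl, mul_nonneg hRr (by linarith)⟩

lemma clamp_bounded (hu : LipClass Rl Rr u) {a b : ℝ} (hab : a ≤ b) (y : ℝ) :
    |u (max a (min b y))| ≤ |u a| + |u b| := by
  have h1 := hu.monotone (le_max_left a (min b y))
  have h2 := hu.monotone (max_le hab (min_le_left b y))
  rw [abs_le]
  constructor
  · linarith [neg_abs_le (u a), abs_nonneg (u b)]
  · linarith [le_abs_self (u b), abs_nonneg (u a)]

end LipClass

/-! ### Semigroups with a local comparison principle -/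

/-- The consequences of the semigroup axioms used below: a semigroup on `Lip` commuting with
constants and with the hyperbolic scaling, with a comparison principle on cones of speed `C0`. -/
structure LocalSemigroup (Rl Rr C0 : ℝ) (S : ℝ → (ℝ → ℝ) → (ℝ → ℝ)) : Prop where
  speed_pos : 0 < C0
  lipClass : ∀ t u, 0 ≤ t → LipClass Rl Rr u → LipClass Rl Rr (S t u)
  semigroup : ∀ s t : ℝ, 0 ≤ s → 0 ≤ t → ∀ u, LipClass Rl Rr u → S (t + s) u = S t (S s u)
  comparison : ∀ u v, LipClass Rl Rr u → LipClass Rl Rr v → ∀ t x c : ℝ, 0 ≤ t →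
    (∀ y, |y - x| ≤ C0 * t → u y ≤ v y + c) → S t u x ≤ S t v x + c
  scaling : ∀ ε t : ℝ, 0 < ε → 0 < t → ∀ u, LipClass Rl Rr u → ∀ x : ℝ,
    ε * S (t / ε) (fun y => ε * u (y / ε)) (x / ε) = S t u x

/-- A sup-norm contraction commuting with constants, with finite speed of propagation, satisfies a
local comparison principle. -/
lemma local_comparison {Rl Rr : ℝ} (hRl : 0 ≤ Rl) (hRr : 0 ≤ Rr)
    {S : ℝ → (ℝ → ℝ) → (ℝ → ℝ)}
    (contraction : ∀ u1 u2 : ℝ → ℝ, LipClass Rl Rr u1 → LipClass Rl Rr u2 →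
      (∃ C, ∀ x, |u1 x| ≤ C) → (∃ C, ∀ x, |u2 x| ≤ C) →
      ∀ t, 0 ≤ t → ∀ C : ℝ, (∀ x, |u1 x - u2 x| ≤ C) → ∀ x, |S t u1 x - S t u2 x| ≤ C)
    (add_const : ∀ t, 0 ≤ t → ∀ u0, LipClass Rl Rr u0 → ∀ c x : ℝ,
      S t (fun y => u0 y + c) x = S t u0 x + c)
    {C0 : ℝ} (hC0 : 0 < C0)
    (finite_speed : ∀ u1 u2 : ℝ → ℝ, LipClass Rl Rr u1 → LipClass Rl Rr u2 → ∀ a b : ℝ,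
      (∀ x ∈ Icc a b, u1 x = u2 x) → ∀ t : ℝ, 0 ≤ t → t ≤ C0⁻¹ * (b - a) →
      ∀ x ∈ Icc (a + C0 * t) (b - C0 * t), S t u1 x = S t u2 x)
    {u v : ℝ → ℝ} (hu : LipClass Rl Rr u) (hv : LipClass Rl Rr v) {t x c : ℝ} (ht : 0 ≤ t)
    (huv : ∀ y, |y - x| ≤ C0 * t → u y ≤ v y + c) : S t u x ≤ S t v x + c := by
  have hCt : 0 ≤ C0 * t := by positivity
  set a := x - C0 * t with ha
  set b := x + C0 * t with hb
  have hab : a ≤ b := by linarith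
  have local_eq : ∀ w, LipClass Rl Rr w → S t w x = S t (fun y => w (max a (min b y))) x := by
    intro w hw
    refine finite_speed w _ hw (hw.clamp hRl hRr hab) a b ?_ t ht ?_ x ⟨by linarith, by linarith⟩
    · intro y hy
      simp only [min_eq_right hy.2, max_eq_right hy.1]
    · have : C0⁻¹ * (b - a) = 2 * t := by rw [ha, hb]; field_simp; ring
      linarith
  have hle : ∀ y, u (max a (min b y)) ≤ v (max a (min b y)) + c := by
    intro y
    apply huv
    have h1 := le_max_left a (min b y)
    have h2 := max_le hab (min_le_left b y)
    rw [abs_le]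
    constructor <;> linarith
  have hub := hu.clamp_bounded hab
  have hvb := hv.clamp_bounded hab
  set M := (|u a| + |u b|) + (|v a| + |v b|) + |c| with hM
  have hw := (hv.clamp hRl hRr hab).add_const (c - M / 2)
  have key := contraction _ _ (hu.clamp hRl hRr hab) hw ⟨_, hub⟩
    ⟨|v a| + |v b| + |c - M / 2|, fun y => (abs_add_le _ _).trans (by linarith [hvb y])⟩
    t ht (M / 2) (fun y => by
      have h1 := hle y
      have h2 := abs_le.1 (hub y)
      have h3 := abs_le.1 (hvb y)
      have h4 := le_abs_self c
      rw [abs_le]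
      constructor <;> linarith) x
  rw [add_const t ht _ (hv.clamp hRl hRr hab)] at key
  rw [local_eq u hu, local_eq v hv]
  linarith [(abs_le.1 key).2]

/-! ### One step of the semigroup and touching functions -/

namespace LocalSemigroup

variable {Rl Rr C0 : ℝ} {S : ℝ → (ℝ → ℝ) → (ℝ → ℝ)}

/-- If `S` transports the profile `ℓ` at speed `lam` at `x0` and the solution lies above an
expansion with profile `ℓ` and time slope `a` in the backward cone, then `0 ≤ a + lam`. -/
lemma step_super (hS : LocalSemigroup Rl Rr C0 S) {u0 ℓ : ℝ → ℝ} (hu0 : LipClass Rl Rr u0)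
    (hℓ : LipClass Rl Rr ℓ) {t0 x0 a lam : ℝ} (ht0 : 0 < t0)
    (hlam : ∀ᶠ h in 𝓝[>] (0 : ℝ), S h ℓ x0 = ℓ x0 - h * lam)
    (hlow : ∀ ε > 0, ∀ᶠ h in 𝓝[>] (0 : ℝ), ∀ y, |y - x0| ≤ C0 * h →
      S t0 u0 x0 - a * h + (ℓ y - ℓ x0) - ε * h ≤ S (t0 - h) u0 y) : 0 ≤ a + lam := by
  refine le_of_forall_pos_le_add fun ε hε => ?_
  have hlt : ∀ᶠ h in 𝓝[>] (0 : ℝ), h < t0 := nhdsWithin_le_nhds (Iio_mem_nhds ht0)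
  obtain ⟨h, hlam, hlow, hlt, hpos⟩ :=
    (hlam.and ((hlow ε hε).and (hlt.and self_mem_nhdsWithin))).exists
  have hpos : 0 < h := hpos
  have hsg := hS.semigroup (t0 - h) h (by linarith) hpos.le u0 hu0
  rw [add_sub_cancel] at hsg
  have hcmp := hS.comparison ℓ (S (t0 - h) u0) hℓ (hS.lipClass _ _ (by linarith) hu0) h x0
    (-(S t0 u0 x0 - a * h - ℓ x0 - ε * h)) hpos.le fun y hy => by linarith [hlow y hy]
  rw [← hsg, hlam] at hcmp
  have : 0 ≤ h * (a + lam + ε) := by nlinarith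
  linarith [nonneg_of_mul_nonneg_right this hpos]

/-- The upper counterpart of `LocalSemigroup.step_super`. -/
lemma step_sub (hS : LocalSemigroup Rl Rr C0 S) {u0 ℓ : ℝ → ℝ} (hu0 : LipClass Rl Rr u0)
    (hℓ : LipClass Rl Rr ℓ) {t0 x0 a lam : ℝ} (ht0 : 0 < t0)
    (hlam : ∀ᶠ h in 𝓝[>] (0 : ℝ), S h ℓ x0 = ℓ x0 - h * lam)
    (hup : ∀ ε > 0, ∀ᶠ h in 𝓝[>] (0 : ℝ), ∀ y, |y - x0| ≤ C0 * h →
      S (t0 - h) u0 y ≤ S t0 u0 x0 - a * h + (ℓ y - ℓ x0) + ε * h) : a + lam ≤ 0 := by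
  refine le_of_forall_pos_le_add fun ε hε => ?_
  have hlt : ∀ᶠ h in 𝓝[>] (0 : ℝ), h < t0 := nhdsWithin_le_nhds (Iio_mem_nhds ht0)
  obtain ⟨h, hlam, hup, hlt, hpos⟩ :=
    (hlam.and ((hup ε hε).and (hlt.and self_mem_nhdsWithin))).exists
  have hpos : 0 < h := hpos
  have hsg := hS.semigroup (t0 - h) h (by linarith) hpos.le u0 hu0
  rw [add_sub_cancel] at hsg
  have hcmp := hS.comparison (S (t0 - h) u0) ℓ (hS.lipClass _ _ (by linarith) hu0) hℓ h x0
    (S t0 u0 x0 - a * h - ℓ x0 + ε * h) hpos.le fun y hy => by linarith [hup y hy]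
  rw [← hsg, hlam] at hcmp
  have : 0 ≤ h * (ε - (a + lam)) := by nlinarith
  linarith [nonneg_of_mul_nonneg_right this hpos]

end LocalSemigroup

/-- A neighbourhood of a point contains the tips of its backward cones. -/
lemma eventually_cone {t0 x0 C0 : ℝ} (hC0 : 0 < C0) {P : ℝ × ℝ → Prop}
    (hP : ∀ᶠ z in 𝓝 (t0, x0), P z) :
    ∀ᶠ h in 𝓝[>] (0 : ℝ), ∀ y, |y - x0| ≤ C0 * h → P (t0 - h, y) := by
  obtain ⟨δ, hδ, hball⟩ := Metric.eventually_nhds_iff.1 hP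
  have h1 : ∀ᶠ h in 𝓝[>] (0 : ℝ), h < δ := nhdsWithin_le_nhds (Iio_mem_nhds hδ)
  have h2 : ∀ᶠ h in 𝓝[>] (0 : ℝ), h < δ / C0 :=
    nhdsWithin_le_nhds (Iio_mem_nhds (by positivity))
  filter_upwards [h1, h2, self_mem_nhdsWithin] with h h1 h2 hpos y hy
  have hpos : 0 < h := hpos
  apply hball
  rw [Prod.dist_eq, max_lt_iff, Real.dist_eq, Real.dist_eq]
  refine ⟨?_, ?_⟩
  · rw [abs_lt]; constructor <;> simp only <;> linarith
  · rw [lt_div_iff₀ hC0] at h2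
    exact hy.trans_lt (by linarith)

/-- First order expansion of a differentiable function in a backward cone. -/
lemma HasFDerivAt.eventually_cone {Φ : ℝ × ℝ → ℝ} {L : ℝ × ℝ →L[ℝ] ℝ} {t0 x0 C0 : ℝ}
    (hC0 : 0 < C0) (hΦ : HasFDerivAt Φ L (t0, x0)) {ε : ℝ} (hε : 0 < ε) :
    ∀ᶠ h in 𝓝[>] (0 : ℝ), ∀ y, |y - x0| ≤ C0 * h →
      |Φ (t0 - h, y) - (Φ (t0, x0) - L (1, 0) * h + L (0, 1) * (y - x0))| ≤ ε * h := by
  have h1 := hΦ.isLittleO.def (c := ε / (1 + C0)) (by positivity)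
  filter_upwards [_root_.eventually_cone hC0 h1, self_mem_nhdsWithin] with h hh hpos y hy
  have hpos : 0 < h := hpos
  have key := hh y hy
  have hL : L ((t0 - h, y) - (t0, x0)) = - L (1, 0) * h + L (0, 1) * (y - x0) := by
    have : ((t0 - h, y) - (t0, x0) : ℝ × ℝ) =
        (-h) • ((1, 0) : ℝ × ℝ) + (y - x0) • ((0, 1) : ℝ × ℝ) := by
      ext <;> simp
    rw [this, map_add, map_smul, map_smul, smul_eq_mul, smul_eq_mul]
    ring
  have hn : ‖((t0 - h, y) - (t0, x0) : ℝ × ℝ)‖ ≤ (1 + C0) * h := by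
    rw [Prod.norm_def, Real.norm_eq_abs, Real.norm_eq_abs]
    refine max_le ?_ ?_
    · have : |((t0 - h, y) - (t0, x0) : ℝ × ℝ).1| = h := by
        simp [hpos.le]
      rw [this]; nlinarith
    · have : ((t0 - h, y) - (t0, x0) : ℝ × ℝ).2 = y - x0 := rfl
      rw [this]; nlinarith
  rw [hL, Real.norm_eq_abs] at key
  have h2 : ε / (1 + C0) * ‖((t0 - h, y) - (t0, x0) : ℝ × ℝ)‖ ≤ ε * h := by
    calc _ ≤ ε / (1 + C0) * ((1 + C0) * h) := by gcongr
      _ = ε * h := by field_simp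
  refine le_trans (le_of_eq ?_) (key.trans h2)
  congr 1
  ring

/-- One-sided first order condition on the right. -/
lemma HasDerivAt.nonpos_of_right {g : ℝ → ℝ} {d x0 : ℝ} (hg : HasDerivAt g d x0)
    (h : ∀ᶠ y in 𝓝[>] x0, g y ≤ g x0) : d ≤ 0 := by
  have ht := (hasDerivAt_iff_tendsto_slope.1 hg).mono_left
    (nhdsWithin_mono x0 (fun y (hy : x0 < y) => hy.ne') : 𝓝[>] x0 ≤ 𝓝[≠] x0)
  refine le_of_tendsto ht ?_
  filter_upwards [h, self_mem_nhdsWithin] with y hy hlt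
  have hlt : x0 < y := hlt
  rw [slope_def_field]
  exact div_nonpos_of_nonpos_of_nonneg (by linarith) (by linarith)

/-- One-sided first order condition on the left. -/
lemma HasDerivAt.nonneg_of_left {g : ℝ → ℝ} {d x0 : ℝ} (hg : HasDerivAt g d x0)
    (h : ∀ᶠ y in 𝓝[<] x0, g y ≤ g x0) : 0 ≤ d := by
  have ht := (hasDerivAt_iff_tendsto_slope.1 hg).mono_left
    (nhdsWithin_mono x0 (fun y (hy : y < x0) => hy.ne) : 𝓝[<] x0 ≤ 𝓝[≠] x0)
  refine ge_of_tendsto ht ?_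
  filter_upwards [h, self_mem_nhdsWithin] with y hy hlt
  have hlt : y < x0 := hlt
  rw [slope_def_field]
  exact div_nonneg_of_nonpos (by linarith) (by linarith)

/-- The derivative is at most a bound for right increments. -/
lemma HasDerivAt.le_of_right {g : ℝ → ℝ} {d x0 R : ℝ} (hg : HasDerivAt g d x0)
    (h : ∀ᶠ y in 𝓝[>] x0, g y - g x0 ≤ R * (y - x0)) : d ≤ R := by
  have := (hg.sub ((hasDerivAt_id x0).const_mul R)).nonpos_of_right (by
    filter_upwards [h] with y hy
    simp only [id, Pi.sub_apply]; linarith)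
  linarith

lemma HasDerivAt.ge_of_right {g : ℝ → ℝ} {d x0 R : ℝ} (hg : HasDerivAt g d x0)
    (h : ∀ᶠ y in 𝓝[>] x0, R * (y - x0) ≤ g y - g x0) : R ≤ d := by
  have := (((hasDerivAt_id x0).const_mul R).sub hg).nonpos_of_right (by
    filter_upwards [h] with y hy
    simp only [id, Pi.sub_apply]; linarith)
  linarith

lemma HasDerivAt.ge_of_left {g : ℝ → ℝ} {d x0 R : ℝ} (hg : HasDerivAt g d x0)
    (h : ∀ᶠ y in 𝓝[<] x0, g y - g x0 ≤ R * (y - x0)) : R ≤ d := by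
  have := (hg.sub ((hasDerivAt_id x0).const_mul R)).nonneg_of_left (by
    filter_upwards [h] with y hy
    simp only [id, Pi.sub_apply]; linarith)
  linarith

lemma HasDerivAt.le_of_left {g : ℝ → ℝ} {d x0 R : ℝ} (hg : HasDerivAt g d x0)
    (h : ∀ᶠ y in 𝓝[<] x0, R * (y - x0) ≤ g y - g x0) : d ≤ R := by
  have := (((hasDerivAt_id x0).const_mul R).sub hg).nonneg_of_left (by
    filter_upwards [h] with y hy
    simp only [id, Pi.sub_apply]; linarith)
  linarith

lemma HasFDerivAt.hasDerivAt_snd {Φ : ℝ × ℝ → ℝ} {L : ℝ × ℝ →L[ℝ] ℝ} {t0 x0 : ℝ}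
    (hΦ : HasFDerivAt Φ L (t0, x0)) : HasDerivAt (fun y => Φ (t0, y)) (L (0, 1)) x0 :=
  hΦ.comp_hasDerivAt x0 ((hasDerivAt_const x0 t0).prodMk (hasDerivAt_id x0))

lemma HasFDerivAt.hasDerivAt_fst {Φ : ℝ × ℝ → ℝ} {L : ℝ × ℝ →L[ℝ] ℝ} {t0 x0 : ℝ}
    (hΦ : HasFDerivAt Φ L (t0, x0)) : HasDerivAt (fun s => Φ (s, x0)) (L (1, 0)) t0 :=
  hΦ.comp_hasDerivAt t0 ((hasDerivAt_id t0).prodMk (hasDerivAt_const t0 x0))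

lemma eventually_nhds_prodMk_right {t0 x0 : ℝ} {P : ℝ × ℝ → Prop}
    (hP : ∀ᶠ z in 𝓝 (t0, x0), P z) : ∀ᶠ y in 𝓝 x0, P (t0, y) :=
  (Continuous.prodMk_right t0).continuousAt.eventually hP

/-- Near `x0`, functions of `Lip` have slopes in `[0, R]`, and `S` moves affine profiles of slope
`p` at speed `H p`. -/
structure LocallyLinear (Rl Rr : ℝ) (S : ℝ → (ℝ → ℝ) → (ℝ → ℝ)) (x0 R : ℝ) (H : ℝ → ℝ) :
    Prop where
  slope : ∀ v, LipClass Rl Rr v → ∀ᶠ y in 𝓝 x0,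
    (x0 ≤ y → 0 ≤ v y - v x0 ∧ v y - v x0 ≤ R * (y - x0)) ∧
    (y ≤ x0 → v y - v x0 ≤ 0 ∧ R * (y - x0) ≤ v y - v x0)
  transport : ∀ p ∈ Icc 0 R, ∃ ℓ, LipClass Rl Rr ℓ ∧
    (∀ᶠ y in 𝓝 x0, ℓ y - ℓ x0 = p * (y - x0)) ∧
    ∀ᶠ h in 𝓝[>] (0 : ℝ), S h ℓ x0 = ℓ x0 - h * H p

namespace LocallyLinear

variable {Rl Rr C0 : ℝ} {S : ℝ → (ℝ → ℝ) → (ℝ → ℝ)} {x0 R : ℝ} {H : ℝ → ℝ}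

/-- The supersolution property at a point where `S` is locally linear. -/
lemma touch_super (hloc : LocallyLinear Rl Rr S x0 R H) (hS : LocalSemigroup Rl Rr C0 S)
    {u0 : ℝ → ℝ} (hu0 : LipClass Rl Rr u0) {t0 : ℝ} (ht0 : 0 < t0)
    {Φ : ℝ × ℝ → ℝ} {L : ℝ × ℝ →L[ℝ] ℝ} (hΦ : HasFDerivAt Φ L (t0, x0))
    (hmin : ∀ᶠ z in 𝓝 (t0, x0), S t0 u0 x0 - Φ (t0, x0) ≤ S z.1 u0 z.2 - Φ z) :
    L (0, 1) ∈ Icc 0 R ∧ 0 ≤ L (1, 0) + H (L (0, 1)) := by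
  have hx := eventually_nhds_prodMk_right hmin
  have hv := hloc.slope _ (hS.lipClass t0 u0 ht0.le hu0)
  have hp : L (0, 1) ∈ Icc 0 R := by
    constructor
    · refine hΦ.hasDerivAt_snd.ge_of_left ?_
      filter_upwards [nhdsWithin_le_nhds hx, nhdsWithin_le_nhds hv, self_mem_nhdsWithin]
        with y h1 h2 h3
      linarith [(h2.2 (le_of_lt h3)).1]
    · refine hΦ.hasDerivAt_snd.le_of_right ?_
      filter_upwards [nhdsWithin_le_nhds hx, nhdsWithin_le_nhds hv, self_mem_nhdsWithin]
        with y h1 h2 h3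
      linarith [(h2.1 (le_of_lt h3)).2]
  obtain ⟨ℓ, hℓ, hlin, hlam⟩ := hloc.transport _ hp
  refine ⟨hp, hS.step_super hu0 hℓ ht0 hlam fun ε hε => ?_⟩
  have hlin' : ∀ᶠ z : ℝ × ℝ in 𝓝 (t0, x0), ℓ z.2 - ℓ x0 = L (0, 1) * (z.2 - x0) :=
    (continuous_snd.tendsto (t0, x0)).eventually hlin
  filter_upwards [hΦ.eventually_cone hS.speed_pos hε, eventually_cone hS.speed_pos hmin,
    eventually_cone hS.speed_pos hlin'] with h h1 h2 h3 y hy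
  have h1 := abs_le.1 (h1 y hy)
  have h2 := h2 y hy
  have h3 := h3 y hy
  rw [h3]
  linarith [h1.1]

/-- The subsolution property at a point where `S` is locally linear. -/
lemma touch_sub (hloc : LocallyLinear Rl Rr S x0 R H) (hS : LocalSemigroup Rl Rr C0 S)
    {u0 : ℝ → ℝ} (hu0 : LipClass Rl Rr u0) {t0 : ℝ} (ht0 : 0 < t0)
    {Φ : ℝ × ℝ → ℝ} {L : ℝ × ℝ →L[ℝ] ℝ} (hΦ : HasFDerivAt Φ L (t0, x0))
    (hmax : ∀ᶠ z in 𝓝 (t0, x0), S z.1 u0 z.2 - Φ z ≤ S t0 u0 x0 - Φ (t0, x0)) :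
    L (0, 1) ∈ Icc 0 R ∧ L (1, 0) + H (L (0, 1)) ≤ 0 := by
  have hx := eventually_nhds_prodMk_right hmax
  have hv := hloc.slope _ (hS.lipClass t0 u0 ht0.le hu0)
  have hp : L (0, 1) ∈ Icc 0 R := by
    constructor
    · refine hΦ.hasDerivAt_snd.ge_of_right ?_
      filter_upwards [nhdsWithin_le_nhds hx, nhdsWithin_le_nhds hv, self_mem_nhdsWithin]
        with y h1 h2 h3
      linarith [(h2.1 (le_of_lt h3)).1]
    · refine hΦ.hasDerivAt_snd.le_of_left ?_
      filter_upwards [nhdsWithin_le_nhds hx, nhdsWithin_le_nhds hv, self_mem_nhdsWithin]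
        with y h1 h2 h3
      linarith [(h2.2 (le_of_lt h3)).2]
  obtain ⟨ℓ, hℓ, hlin, hlam⟩ := hloc.transport _ hp
  refine ⟨hp, hS.step_sub hu0 hℓ ht0 hlam fun ε hε => ?_⟩
  have hlin' : ∀ᶠ z : ℝ × ℝ in 𝓝 (t0, x0), ℓ z.2 - ℓ x0 = L (0, 1) * (z.2 - x0) :=
    (continuous_snd.tendsto (t0, x0)).eventually hlin
  filter_upwards [hΦ.eventually_cone hS.speed_pos hε, eventually_cone hS.speed_pos hmax,
    eventually_cone hS.speed_pos hlin'] with h h1 h2 h3 y hy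
  have h1 := abs_le.1 (h1 y hy)
  have h2 := h2 y hy
  have h3 := h3 y hy
  rw [h3]
  linarith [h1.2]

end LocallyLinear

/-! ### Self-similar profiles on a half-line -/

/-- `U` is a viscosity solution of `U - ξ U' + H(U') = 0` on `(-∞, 0)`, continuous up to `0`, with
slopes in `[α, β]`. This is the equation of the profile of a self-similar solution `t U(x/t)`. -/
structure HalfProfile (α β : ℝ) (H U : ℝ → ℝ) : Prop where
  continuousOn : ContinuousOn U (Iic 0)
  super : ∀ ξ < 0, ∀ (ψ : ℝ → ℝ) (q : ℝ), HasDerivAt ψ q ξ →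
    (∀ᶠ y in 𝓝 ξ, U ξ - ψ ξ ≤ U y - ψ y) → q ∈ Icc α β ∧ 0 ≤ U ξ - ξ * q + H q
  sub : ∀ ξ < 0, ∀ (ψ : ℝ → ℝ) (q : ℝ), HasDerivAt ψ q ξ →
    (∀ᶠ y in 𝓝 ξ, U y - ψ y ≤ U ξ - ψ ξ) → q ∈ Icc α β ∧ U ξ - ξ * q + H q ≤ 0
  exists_differentiableAt : ∀ r > 0, ∃ ξ ∈ Ioo (-r) 0, DifferentiableAt ℝ U ξ

namespace HalfProfile

variable {α β : ℝ} {H U : ℝ → ℝ}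

/-- The flux `-U 0` at the boundary is approached by values of `H` on `[α, β]`. -/
lemma exists_flux (hU : HalfProfile α β H U) {ε : ℝ} (hε : 0 < ε) :
    ∃ q ∈ Icc α β, |-U 0 - H q| ≤ ε := by
  have hcont : Tendsto U (𝓝[<] 0) (𝓝 (U 0)) :=
    (hU.continuousOn 0 self_mem_Iic).mono_left (nhdsWithin_mono _ Iio_subset_Iic_self)
  have h1 : ∀ᶠ ξ in 𝓝[<] (0 : ℝ), |U ξ - U 0| < ε / 2 := by
    have := Metric.tendsto_nhds.1 hcont (ε / 2) (by positivity)
    simpa [Real.dist_eq] using this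
  obtain ⟨r, hr, hsub⟩ := mem_nhdsLT_iff_exists_Ioo_subset.1 h1
  have hr : r < 0 := hr
  set B := |α| + |β| + 1 with hB
  have hBpos : 0 < B := by positivity
  obtain ⟨ξ, hξ, hdiff⟩ := hU.exists_differentiableAt (min (-r) (ε / (2 * B)))
    (lt_min (by linarith) (by positivity))
  have hξr : ξ ∈ Ioo r 0 :=
    ⟨by linarith [hξ.1, min_le_left (-r) (ε / (2 * B))], hξ.2⟩
  have hξB : -ξ < ε / (2 * B) := by linarith [hξ.1, min_le_right (-r) (ε / (2 * B))]
  obtain ⟨hq, hsup⟩ := hU.super ξ hξ.2 U _ hdiff.hasDerivAt (Eventually.of_forall (by simp))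
  obtain ⟨-, hsubsol⟩ := hU.sub ξ hξ.2 U _ hdiff.hasDerivAt (Eventually.of_forall (by simp))
  refine ⟨_, hq, ?_⟩
  set q := deriv U ξ
  have hqB : |q| ≤ B := by
    rw [abs_le]
    constructor
    · linarith [hq.1, neg_abs_le α, abs_nonneg β]
    · linarith [hq.2, le_abs_self β, abs_nonneg α]
  have hξq : |ξ * q| ≤ ε / 2 := by
    rw [abs_mul, abs_of_neg hξ.2]
    calc -ξ * |q| ≤ ε / (2 * B) * B := by
          apply mul_le_mul hξB.le hqB (abs_nonneg _) (by positivity)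
      _ = ε / 2 := by field_simp
  have hUξ : |U ξ - U 0| < ε / 2 := hsub hξr
  rw [abs_lt] at hUξ
  rw [abs_le] at hξq ⊢
  constructor <;> linarith

lemma neg_boundary_le (hU : HalfProfile α β H U) {M : ℝ} (hM : ∀ q ∈ Icc α β, H q ≤ M) :
    -U 0 ≤ M := by
  refine le_of_forall_pos_le_add fun ε hε => ?_
  obtain ⟨q, hq, h⟩ := hU.exists_flux hε
  linarith [hM q hq, (abs_le.1 h).2]

lemma neg_boundary_nonneg (hU : HalfProfile α β H U) (hM : ∀ q ∈ Icc α β, 0 ≤ H q) :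
    0 ≤ -U 0 := by
  refine le_of_forall_pos_le_add fun ε hε => ?_
  obtain ⟨q, hq, h⟩ := hU.exists_flux hε
  linarith [hM q hq, (abs_le.1 h).1]

/-- If the slope at `-∞` lies on the increasing branch of `H`, the boundary flux is at most the
incoming flux. -/
lemma neg_boundary_le_incoming (hU : HalfProfile α β H U) {p c L : ℝ} (hc : 0 ≤ c)
    (htan : ∀ q ∈ Icc α β, H q ≤ H p + c * (q - p)) (hL : 0 < L)
    (hUL : U (-L) = p * (-L) - H p) : -U 0 ≤ H p := by
  by_contra hcon
  push Not at hcon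
  set V : ℝ → ℝ := fun ξ => U ξ - (p * ξ - H p) with hV
  have hVc : ContinuousOn V (Icc (-L) 0) :=
    (hU.continuousOn.mono Icc_subset_Iic_self).sub (by fun_prop)
  have hgc : ContinuousOn (fun ξ => V ξ * (-ξ)) (Icc (-L) 0) := hVc.mul (by fun_prop)
  obtain ⟨ξ0, hξ0, hmin⟩ := isCompact_Icc.exists_isMinOn ⟨-L, by simp [hL.le]⟩ hgc
  have hneg : V ξ0 * (-ξ0) < 0 := by
    have h1 : Tendsto V (𝓝[<] 0) (𝓝 (V 0)) := by
      have := (hVc 0 (by simp [hL.le])).mono_left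
        (nhdsWithin_mono _ (Ico_subset_Icc_self : Ico (-L) 0 ⊆ _))
      rwa [nhdsWithin_Ico_eq_nhdsLT (by linarith)] at this
    have hV0 : V 0 < 0 := by simp only [hV]; linarith
    obtain ⟨ξ, h2, h3⟩ := ((h1.eventually (gt_mem_nhds hV0)).and
      (Ioo_mem_nhdsLT (by linarith : -L < 0))).exists
    have := hmin (Ioo_subset_Icc_self h3)
    simp only [mem_ofPred_eq] at this
    nlinarith [h3.2]
  have hξ1 : ξ0 < 0 := by
    rcases hξ0.2.eq_or_lt with h | h
    · rw [h] at hneg; simp at hneg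
    · exact h
  have hξ2 : -L < ξ0 := by
    rcases hξ0.1.eq_or_lt with h | h
    · have : V ξ0 = 0 := by simp only [hV, ← h]; rw [hUL]; ring
      rw [this] at hneg; simp at hneg
    · exact h
  have hVneg : V ξ0 < 0 := by nlinarith
  set g := V ξ0 * (-ξ0) with hg
  have hder : HasDerivAt (fun ξ => p * ξ - H p + g * (-ξ)⁻¹) (p + g * (ξ0 ^ 2)⁻¹) ξ0 := by
    have h1 : HasDerivAt (fun ξ : ℝ => (-ξ)⁻¹) (-(-1) / (-ξ0) ^ 2) ξ0 :=
      (hasDerivAt_id ξ0).neg.inv (by simpa using hξ1.ne)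
    have h2 := (((hasDerivAt_id ξ0).const_mul p).sub_const (H p)).add (h1.const_mul g)
    refine h2.congr_deriv ?_
    rw [neg_sq, div_eq_mul_inv]; ring
  obtain ⟨hq, hsup⟩ := hU.super ξ0 hξ1 _ _ hder (by
    filter_upwards [Ioo_mem_nhds hξ2 hξ1] with y hy
    have h1 := hmin (Ioo_subset_Icc_self hy)
    simp only [mem_ofPred_eq, ← hg] at h1
    have h2 : g * (-y)⁻¹ ≤ V y := by
      rw [← div_eq_mul_inv, div_le_iff₀ (by linarith [hy.2])]; exact h1
    have h3 : g * (-ξ0)⁻¹ = V ξ0 := by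
      rw [hg]; field_simp [hξ1.ne]
    simp only [hV] at h2 h3
    linarith)
  have h4 := htan _ hq
  have h5 : V ξ0 ≥ (ξ0 - c) * (g * (ξ0 ^ 2)⁻¹) := by simp only [hV]; nlinarith
  have h6 : g * (ξ0 ^ 2)⁻¹ < 0 :=
    mul_neg_of_neg_of_pos hneg (inv_pos.2 (sq_pos_of_ne_zero hξ1.ne))
  nlinarith

/-- On the decreasing branch of `H`, a slope `q` of flux at most the boundary flux yields a line
through the boundary value lying below the profile. -/
lemma boundary_add_le (hU : HalfProfile α β H U) {q c : ℝ} (hc : c < 0)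
    (htan : ∀ p ∈ Icc α β, H p ≤ H q + c * (p - q)) (hq : H q ≤ -U 0) :
    ∀ ξ ∈ Icc c 0, q * ξ + U 0 ≤ U ξ := by
  by_contra! hcon
  obtain ⟨ξ1, hξ1, hlt⟩ := hcon
  set V : ℝ → ℝ := fun ξ => U ξ - (q * ξ + U 0) with hV
  have hVc : ContinuousOn V (Icc c 0) :=
    (hU.continuousOn.mono Icc_subset_Iic_self).sub (by fun_prop)
  have hV0 : V 0 = 0 := by simp [hV]
  have hVξ1 : V ξ1 < 0 := by simp only [hV]; linarith
  obtain ⟨ξ2, hξ2, hVξ2⟩ : ∃ ξ2 ∈ Ioo c 0, V ξ2 < 0 := by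
    have hne : ξ1 ≠ 0 := by rintro rfl; linarith
    rcases hξ1.1.eq_or_lt with h | h
    · subst h
      have h1 : Tendsto V (𝓝[>] c) (𝓝 (V c)) := by
        have := (hVc c (by simp [hc.le])).mono_left
          (nhdsWithin_mono _ (Ioc_subset_Icc_self : Ioc c 0 ⊆ _))
        rwa [nhdsWithin_Ioc_eq_nhdsGT hc] at this
      obtain ⟨ξ, h2, h3⟩ := ((h1.eventually (gt_mem_nhds hVξ1)).and (Ioo_mem_nhdsGT hc)).exists
      exact ⟨ξ, h3, h2⟩
    · exact ⟨ξ1, ⟨h, lt_of_le_of_ne hξ1.2 hne⟩, hVξ1⟩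
  have hgc : ContinuousOn (fun ξ => V ξ * (ξ - c)) (Icc c 0) := hVc.mul (by fun_prop)
  obtain ⟨ξ0, hξ0, hmin⟩ := isCompact_Icc.exists_isMinOn ⟨c, by simp [hc.le]⟩ hgc
  have hneg : V ξ0 * (ξ0 - c) < 0 := by
    have := hmin (Ioo_subset_Icc_self hξ2)
    simp only [mem_ofPred_eq] at this
    nlinarith [hξ2.1]
  have hξ01 : ξ0 < 0 := by
    rcases hξ0.2.eq_or_lt with h | h
    · rw [h, hV0] at hneg; simp at hneg
    · exact h
  have hξ02 : c < ξ0 := by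
    rcases hξ0.1.eq_or_lt with h | h
    · rw [← h] at hneg; simp at hneg
    · exact h
  have hVneg : V ξ0 < 0 := by nlinarith
  set g := V ξ0 * (ξ0 - c) with hg
  have hne : ξ0 - c ≠ 0 := by linarith
  have hder : HasDerivAt (fun ξ => q * ξ + U 0 + g * (ξ - c)⁻¹)
      (q - g * ((ξ0 - c) ^ 2)⁻¹) ξ0 := by
    have h1 : HasDerivAt (fun ξ : ℝ => (ξ - c)⁻¹) (-1 / (ξ0 - c) ^ 2) ξ0 :=
      ((hasDerivAt_id ξ0).sub_const c).inv hne
    have h2 := (((hasDerivAt_id ξ0).const_mul q).add_const (U 0)).add (h1.const_mul g)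
    refine h2.congr_deriv ?_
    rw [div_eq_mul_inv]; ring
  obtain ⟨hp, hsup⟩ := hU.super ξ0 hξ01 _ _ hder (by
    filter_upwards [Ioo_mem_nhds hξ02 hξ01] with y hy
    have h1 := hmin (Ioo_subset_Icc_self hy)
    simp only [mem_ofPred_eq, ← hg] at h1
    have h2 : g * (y - c)⁻¹ ≤ V y := by
      rw [← div_eq_mul_inv, div_le_iff₀ (by linarith [hy.1])]; exact h1
    have h3 : g * (ξ0 - c)⁻¹ = V ξ0 := by
      rw [hg]; field_simp
    simp only [hV] at h2 h3
    linarith)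
  have h4 := htan _ hp
  have h5 : V ξ0 ≥ (ξ0 - c) * (-(g * ((ξ0 - c) ^ 2)⁻¹)) := by simp only [hV]; nlinarith
  have h6 : g * ((ξ0 - c) ^ 2)⁻¹ < 0 := mul_neg_of_neg_of_pos hneg (by positivity)
  nlinarith

/-- Comparison of a profile with the maximum of two affine profiles. -/
lemma le_max (hU : HalfProfile α β H U) (hH : ConcaveOn ℝ (Icc α β) H) {p q L : ℝ}
    (hp : p ∈ Icc α β) (hq : q ∈ Icc α β)
    (hUL : U (-L) ≤ max (p * (-L) - H p) (q * (-L) - H q))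
    (hU0 : U 0 ≤ max (-H p) (-H q)) :
    ∀ ξ ∈ Icc (-L) 0, U ξ ≤ max (p * ξ - H p) (q * ξ - H q) := by
  intro ξ hξ
  refine le_of_forall_pos_le_add fun ε hε => ?_
  -- a smooth approximation from above of the maximum
  set m : ℝ → ℝ := fun ξ => ((p * ξ - H p) + (q * ξ - H q)) / 2 with hm
  set d : ℝ → ℝ := fun ξ => ((p * ξ - H p) - (q * ξ - H q)) / 2 with hd
  set Ψ : ℝ → ℝ := fun ξ => m ξ + √(d ξ ^ 2 + ε ^ 2) with hΨ
  have hmax : ∀ ξ, max (p * ξ - H p) (q * ξ - H q) = m ξ + |d ξ| := by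
    intro ξ
    simp only [hm, hd]
    rcases le_total (p * ξ - H p) (q * ξ - H q) with h | h
    · rw [max_eq_right h, abs_of_nonpos (by linarith)]; ring
    · rw [max_eq_left h, abs_of_nonneg (by linarith)]; ring
  have hsqrt_pos : ∀ ξ, 0 < √(d ξ ^ 2 + ε ^ 2) := fun ξ => Real.sqrt_pos.2 (by positivity)
  have hlow : ∀ ξ, max (p * ξ - H p) (q * ξ - H q) ≤ Ψ ξ := by
    intro ξ
    rw [hmax, hΨ]
    have : |d ξ| ≤ √(d ξ ^ 2 + ε ^ 2) := Real.abs_le_sqrt (by nlinarith)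
    simpa using this
  have hupp : Ψ ξ ≤ max (p * ξ - H p) (q * ξ - H q) + ε := by
    rw [hmax, hΨ]
    have : √(d ξ ^ 2 + ε ^ 2) ≤ |d ξ| + ε := by
      rw [Real.sqrt_le_left (by positivity)]
      nlinarith [abs_nonneg (d ξ), sq_abs (d ξ)]
    simp only
    linarith
  refine le_trans ?_ hupp
  have hgc : ContinuousOn (fun ξ => U ξ - Ψ ξ) (Icc (-L) 0) :=
    (hU.continuousOn.mono Icc_subset_Iic_self).sub (by fun_prop)
  obtain ⟨ξ0, hξ0, hmaxon⟩ := isCompact_Icc.exists_isMaxOn ⟨ξ, hξ⟩ hgc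
  suffices h : U ξ0 - Ψ ξ0 ≤ 0 by
    have := hmaxon hξ
    simp only [mem_ofPred_eq] at this
    linarith
  by_contra! hpos
  have hξ1 : ξ0 < 0 := by
    rcases hξ0.2.eq_or_lt with h | h
    · have h1 := hlow 0
      simp only [mul_zero, zero_sub] at h1
      rw [h] at hpos; linarith
    · exact h
  have hξ2 : -L < ξ0 := by
    rcases hξ0.1.eq_or_lt with h | h
    · have h1 := hlow (-L)
      rw [← h] at hpos; linarith
    · exact h
  set s := √(d ξ0 ^ 2 + ε ^ 2) with hs
  have hs0 : 0 < s := hsqrt_pos ξ0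
  have hs2 : s ^ 2 = d ξ0 ^ 2 + ε ^ 2 := Real.sq_sqrt (by positivity)
  set θ := (1 + d ξ0 / s) / 2 with hθ
  have hdm : HasDerivAt m ((p + q) / 2) ξ0 := by
    have := ((((hasDerivAt_id ξ0).const_mul p).sub_const (H p)).add
      (((hasDerivAt_id ξ0).const_mul q).sub_const (H q))).div_const 2
    simpa using this
  have hdd : HasDerivAt d ((p - q) / 2) ξ0 := by
    have := ((((hasDerivAt_id ξ0).const_mul p).sub_const (H p)).sub
      (((hasDerivAt_id ξ0).const_mul q).sub_const (H q))).div_const 2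
    simpa using this
  have hder : HasDerivAt Ψ (θ * p + (1 - θ) * q) ξ0 := by
    have hne : d ξ0 ^ 2 + ε ^ 2 ≠ 0 := by positivity
    have h1 : HasDerivAt (fun ξ => √(d ξ ^ 2 + ε ^ 2))
        ((2 * d ξ0 * ((p - q) / 2)) / (2 * s)) ξ0 := by
      have := ((hdd.fun_pow 2).add_const (ε ^ 2)).sqrt hne
      simpa using this
    refine (hdm.add h1).congr_deriv ?_
    rw [hθ]
    field_simp
    ring
  obtain ⟨-, hsub⟩ := hU.sub ξ0 hξ1 _ _ hder (by
    filter_upwards [Ioo_mem_nhds hξ2 hξ1] with y hy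
    exact hmaxon (Ioo_subset_Icc_self hy))
  have hds : |d ξ0| ≤ s := Real.abs_le_sqrt (by nlinarith)
  have hds' : |d ξ0 / s| ≤ 1 := by
    rw [abs_div, abs_of_pos hs0]; exact (div_le_one hs0).2 hds
  rw [abs_le] at hds'
  have hθ0 : 0 ≤ θ := by linarith
  have hθ1 : 0 ≤ 1 - θ := by linarith
  have hconc := hH.2 hp hq hθ0 hθ1 (by ring)
  simp only [smul_eq_mul] at hconc
  have hΨ0 : θ * (p * ξ0 - H p) + (1 - θ) * (q * ξ0 - H q) ≤ Ψ ξ0 := by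
    have h1 : θ * (p * ξ0 - H p) + (1 - θ) * (q * ξ0 - H q) = m ξ0 + d ξ0 ^ 2 / s := by
      simp only [hθ, hm]
      have : d ξ0 ^ 2 / s = d ξ0 / s * (((p * ξ0 - H p) - (q * ξ0 - H q)) / 2) := by
        rw [sq, mul_div_right_comm]
      rw [this]; ring
    have h2 : d ξ0 ^ 2 / s ≤ s := by
      rw [div_le_iff₀ hs0]; nlinarith
    rw [h1]
    simp only [hΨ, ← hs]
    linarith
  nlinarith

end HalfProfile

/-! ### Verifying the definition of flux-limited solutions -/

lemma le_Hplus {H : ℝ → ℝ} (hH : Continuous H) {p y : ℝ} (hy : y ∈ Icc 0 p) :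
    H y ≤ Hplus H p :=
  le_csSup (isCompact_Icc.image hH).bddAbove (mem_image_of_mem H hy)

lemma Hplus_le {H : ℝ → ℝ} {p a : ℝ} (ha : 0 ≤ a) (h : ∀ y ∈ Icc 0 p, H y ≤ a) :
    Hplus H p ≤ a :=
  Real.sSup_le (forall_mem_image.2 h) ha

lemma le_Hminus {H : ℝ → ℝ} (hH : Continuous H) {R p y : ℝ} (hy : y ∈ Icc p R) :
    H y ≤ Hminus H R p :=
  le_csSup (isCompact_Icc.image hH).bddAbove (mem_image_of_mem H hy)

lemma Hminus_le {H : ℝ → ℝ} {R p a : ℝ} (ha : 0 ≤ a) (h : ∀ y ∈ Icc p R, H y ≤ a) :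
    Hminus H R p ≤ a :=
  Real.sSup_le (forall_mem_image.2 h) ha

lemma domHJ_mem_nhds {t : ℝ} (ht : 0 < t) (x : ℝ) : domHJ ∈ 𝓝 (t, x) :=
  prod_mem_nhds (Ici_mem_nhds ht) univ_mem

lemma eventually_snd_neg (t : ℝ) {x : ℝ} (hx : x < 0) :
    ∀ᶠ z : ℝ × ℝ in 𝓝 (t, x), z.2 < 0 :=
  (continuous_snd.tendsto (t, x)).eventually (gt_mem_nhds hx)

lemma eventually_snd_pos (t : ℝ) {x : ℝ} (hx : 0 < x) :
    ∀ᶠ z : ℝ × ℝ in 𝓝 (t, x), 0 < z.2 :=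
  (continuous_snd.tendsto (t, x)).eventually (lt_mem_nhds hx)

lemma JTF.glue_of_nonneg {φl φr : ℝ → ℝ → ℝ} (h : JTF φl φr) (t : ℝ) {x : ℝ} (hx : 0 ≤ x) :
    glue φl φr t x = φr t x := by
  rcases hx.eq_or_lt with rfl | hx
  · simpa [glue] using h.2.2 t
  · exact if_neg (not_le.2 hx)

lemma glue_of_nonpos (φl φr : ℝ → ℝ → ℝ) (t : ℝ) {x : ℝ} (hx : x ≤ 0) :
    glue φl φr t x = φl t x := if_pos hx

/-- A criterion for flux-limited solutions in terms of differentiable touching functions. -/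
lemma FLSol.of_touch {Hl Hr : ℝ → ℝ} {Rl Rr A : ℝ} {u0 : ℝ → ℝ} {u : ℝ → ℝ → ℝ}
    (hcont : ContinuousOn (fun p : ℝ × ℝ => u p.1 p.2) domHJ)
    (hlip : ∀ t : ℝ, 0 ≤ t → LipClass Rl Rr (u t)) (hinit : ∀ x, u 0 x = u0 x)
    (left_sub : ∀ t x : ℝ, 0 < t → x < 0 → ∀ (Φ : ℝ × ℝ → ℝ) (L : ℝ × ℝ →L[ℝ] ℝ),
      HasFDerivAt Φ L (t, x) → (∀ᶠ z in 𝓝 (t, x), u z.1 z.2 - Φ z ≤ u t x - Φ (t, x)) →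
      L (1, 0) + Hl (L (0, 1)) ≤ 0)
    (left_super : ∀ t x : ℝ, 0 < t → x < 0 → ∀ (Φ : ℝ × ℝ → ℝ) (L : ℝ × ℝ →L[ℝ] ℝ),
      HasFDerivAt Φ L (t, x) → (∀ᶠ z in 𝓝 (t, x), u t x - Φ (t, x) ≤ u z.1 z.2 - Φ z) →
      0 ≤ L (1, 0) + Hl (L (0, 1)))
    (right_sub : ∀ t x : ℝ, 0 < t → 0 < x → ∀ (Φ : ℝ × ℝ → ℝ) (L : ℝ × ℝ →L[ℝ] ℝ),
      HasFDerivAt Φ L (t, x) → (∀ᶠ z in 𝓝 (t, x), u z.1 z.2 - Φ z ≤ u t x - Φ (t, x)) →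
      L (1, 0) + Hr (L (0, 1)) ≤ 0)
    (right_super : ∀ t x : ℝ, 0 < t → 0 < x → ∀ (Φ : ℝ × ℝ → ℝ) (L : ℝ × ℝ →L[ℝ] ℝ),
      HasFDerivAt Φ L (t, x) → (∀ᶠ z in 𝓝 (t, x), u t x - Φ (t, x) ≤ u z.1 z.2 - Φ z) →
      0 ≤ L (1, 0) + Hr (L (0, 1)))
    (junction_sub : ∀ t : ℝ, 0 < t → ∀ (Φl Φr : ℝ × ℝ → ℝ) (Ll Lr : ℝ × ℝ →L[ℝ] ℝ),
      HasFDerivAt Φl Ll (t, 0) → HasFDerivAt Φr Lr (t, 0) → Ll (1, 0) = Lr (1, 0) →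
      (∀ᶠ z in 𝓝 (t, (0 : ℝ)), z.2 ≤ 0 → u z.1 z.2 - Φl z ≤ u t 0 - Φl (t, 0)) →
      (∀ᶠ z in 𝓝 (t, (0 : ℝ)), 0 ≤ z.2 → u z.1 z.2 - Φr z ≤ u t 0 - Φr (t, 0)) →
      Ll (1, 0) + min A (min (Hplus Hl (Ll (0, 1))) (Hminus Hr Rr (Lr (0, 1)))) ≤ 0)
    (junction_super : ∀ t : ℝ, 0 < t → ∀ (Φl Φr : ℝ × ℝ → ℝ) (Ll Lr : ℝ × ℝ →L[ℝ] ℝ),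
      HasFDerivAt Φl Ll (t, 0) → HasFDerivAt Φr Lr (t, 0) → Ll (1, 0) = Lr (1, 0) →
      (∀ᶠ z in 𝓝 (t, (0 : ℝ)), z.2 ≤ 0 → u t 0 - Φl (t, 0) ≤ u z.1 z.2 - Φl z) →
      (∀ᶠ z in 𝓝 (t, (0 : ℝ)), 0 ≤ z.2 → u t 0 - Φr (t, 0) ≤ u z.1 z.2 - Φr z) →
      0 ≤ Ll (1, 0) + min A (min (Hplus Hl (Ll (0, 1))) (Hminus Hr Rr (Lr (0, 1))))) :
    FLSol Hl Hr Rl Rr A u0 u := by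
  have fd : ∀ {φ : ℝ → ℝ → ℝ}, ContDiff ℝ 1 (fun p : ℝ × ℝ => φ p.1 p.2) → ∀ t x : ℝ,
      ∃ L : ℝ × ℝ →L[ℝ] ℝ, HasFDerivAt (fun p : ℝ × ℝ => φ p.1 p.2) L (t, x) ∧
        deriv (fun s => φ s x) t = L (1, 0) ∧ deriv (φ t) x = L (0, 1) := by
    intro φ hφ t x
    have h := (hφ.differentiable one_ne_zero (t, x)).hasFDerivAt
    exact ⟨_, h, h.hasDerivAt_fst.deriv, h.hasDerivAt_snd.deriv⟩
  have time_eq : ∀ {φl φr : ℝ → ℝ → ℝ}, JTF φl φr → ∀ t : ℝ,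
      deriv (fun s => φl s 0) t = deriv (fun s => φr s 0) t := by
    intro φl φr h t
    rw [show (fun s => φl s 0) = fun s => φr s 0 from funext h.2.2]
  refine ⟨hcont, hlip, hinit, ?_, ?_⟩
  · intro φl φr hφ t x ht hmax
    rw [IsLocalMaxOn, nhdsWithin_eq_nhds.2 (domHJ_mem_nhds ht x)] at hmax
    obtain ⟨Ll, hLl, hlt, hlx⟩ := fd hφ.1 t x
    obtain ⟨Lr, hLr, hrt, hrx⟩ := fd hφ.2.1 t x
    refine ⟨fun hx => ?_, fun hx => ?_, fun hx => ?_⟩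
    · rw [hlt, hlx]
      refine left_sub t x ht hx _ Ll hLl ?_
      filter_upwards [hmax, eventually_snd_neg t hx] with z hz hzn
      simpa only [glue_of_nonpos _ _ _ hzn.le, glue_of_nonpos _ _ _ hx.le] using hz
    · rw [hrt, hrx]
      refine right_sub t x ht hx _ Lr hLr ?_
      filter_upwards [hmax, eventually_snd_pos t hx] with z hz hzn
      simpa only [hφ.glue_of_nonneg _ hzn.le, hφ.glue_of_nonneg _ hx.le] using hz
    · subst hx
      have hteq := time_eq hφ t
      rw [hlt, hrt] at hteq
      rw [hlt, hlx, hrx]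
      refine junction_sub t ht _ _ Ll Lr hLl hLr hteq ?_ ?_
      · filter_upwards [hmax] with z hz hzn
        simpa only [glue_of_nonpos _ _ _ hzn, glue_of_nonpos _ _ _ le_rfl] using hz
      · filter_upwards [hmax] with z hz hzn
        simpa only [hφ.glue_of_nonneg _ hzn, hφ.glue_of_nonneg _ le_rfl] using hz
  · intro φl φr hφ t x ht hmin
    rw [IsLocalMinOn, nhdsWithin_eq_nhds.2 (domHJ_mem_nhds ht x)] at hmin
    obtain ⟨Ll, hLl, hlt, hlx⟩ := fd hφ.1 t x
    obtain ⟨Lr, hLr, hrt, hrx⟩ := fd hφ.2.1 t x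
    refine ⟨fun hx => ?_, fun hx => ?_, fun hx => ?_⟩
    · rw [hlt, hlx]
      refine left_super t x ht hx _ Ll hLl ?_
      filter_upwards [hmin, eventually_snd_neg t hx] with z hz hzn
      simpa only [glue_of_nonpos _ _ _ hzn.le, glue_of_nonpos _ _ _ hx.le] using hz
    · rw [hrt, hrx]
      refine right_super t x ht hx _ Lr hLr ?_
      filter_upwards [hmin, eventually_snd_pos t hx] with z hz hzn
      simpa only [hφ.glue_of_nonneg _ hzn.le, hφ.glue_of_nonneg _ hx.le] using hz
    · subst hx
      have hteq := time_eq hφ t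
      rw [hlt, hrt] at hteq
      rw [hlt, hlx, hrx]
      refine junction_super t ht _ _ Ll Lr hLl hLr hteq ?_ ?_
      · filter_upwards [hmin] with z hz hzn
        simpa only [glue_of_nonpos _ _ _ hzn, glue_of_nonpos _ _ _ le_rfl] using hz
      · filter_upwards [hmin] with z hz hzn
        simpa only [hφ.glue_of_nonneg _ hzn, hφ.glue_of_nonneg _ le_rfl] using hz

/-! ### Explicit solutions with piecewise affine data -/

section MaxAffine

variable {R : ℝ} {H : ℝ → ℝ} {u : ℝ × ℝ → ℝ} {p₁ p₂ : ℝ} {z₀ : ℝ × ℝ} {Φ : ℝ × ℝ → ℝ}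
  {L : ℝ × ℝ →L[ℝ] ℝ}

lemma ContinuousLinearMap.apply_prod_real (L : ℝ × ℝ →L[ℝ] ℝ) (v : ℝ × ℝ) :
    L v = v.1 * L (1, 0) + v.2 * L (0, 1) := by
  have : v = v.1 • ((1, 0) : ℝ × ℝ) + v.2 • ((0, 1) : ℝ × ℝ) := by ext <;> simp
  conv_lhs => rw [this]
  rw [map_add, map_smul, map_smul, smul_eq_mul, smul_eq_mul]

/-- A function touching a solution from below has directional derivatives bounded by those of any
function which locally majorizes the solution and agrees with it at the touching point. -/
lemma HasFDerivAt.le_of_touch (hΦ : HasFDerivAt Φ L z₀)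
    (hmin : ∀ᶠ z in 𝓝 z₀, u z₀ - Φ z₀ ≤ u z - Φ z) (v : ℝ × ℝ) {m : ℝ}
    (hm : ∀ᶠ s in 𝓝[>] (0 : ℝ), u (z₀ + s • v) - u z₀ ≤ m * s) : L v ≤ m := by
  have hcurve : HasDerivAt (fun s : ℝ => z₀ + s • v) v 0 := by
    simpa using ((hasDerivAt_id (0 : ℝ)).smul_const v).const_add z₀
  have hg : HasDerivAt (fun s : ℝ => Φ (z₀ + s • v)) (L v) 0 := by
    have hΦ' : HasFDerivAt Φ L (z₀ + (0 : ℝ) • v) := by simpa using hΦ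
    exact hΦ'.comp_hasDerivAt 0 hcurve
  have hev : ∀ᶠ s in 𝓝 (0 : ℝ), u z₀ - Φ z₀ ≤ u (z₀ + s • v) - Φ (z₀ + s • v) := by
    have : Tendsto (fun s : ℝ => z₀ + s • v) (𝓝 0) (𝓝 z₀) := by
      simpa using hcurve.continuousAt.tendsto
    exact this.eventually hmin
  refine hg.le_of_right ?_
  filter_upwards [nhdsWithin_le_nhds hev, hm] with s h1 h2
  simp only [zero_smul, add_zero, sub_zero]
  linarith

/-- The maximum of two affine solutions is a subsolution. -/
lemma max_affine_sub
    (hu : ∀ᶠ z in 𝓝 z₀, u z = max (p₁ * z.2 - H p₁ * z.1) (p₂ * z.2 - H p₂ * z.1))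
    (hΦ : HasFDerivAt Φ L z₀) (hmax : ∀ᶠ z in 𝓝 z₀, u z - Φ z ≤ u z₀ - Φ z₀) :
    L (1, 0) + H (L (0, 1)) ≤ 0 := by
  have key : ∀ p, u z₀ = p * z₀.2 - H p * z₀.1 →
      (∀ᶠ z in 𝓝 z₀, p * z.2 - H p * z.1 ≤ u z) → L (1, 0) + H (L (0, 1)) ≤ 0 := by
    intro p h0 hle
    have hdir : ∀ v : ℝ × ℝ, p * v.2 - H p * v.1 ≤ L v := by
      intro v
      have hΦ' : HasFDerivAt (fun z => -Φ z) (-L) z₀ := hΦ.fun_neg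
      have := hΦ'.le_of_touch (u := fun z => -(p * z.2 - H p * z.1)) (by
        filter_upwards [hmax, hle] with z h1 h2
        linarith) v (m := -(p * v.2 - H p * v.1)) (Eventually.of_forall fun s => by
          simp; linarith)
      simp only [_root_.neg_apply] at this
      linarith
    have h1 := hdir (1, 0)
    have h2 := hdir (-1, 0)
    have h3 := hdir (0, 1)
    have h4 := hdir (0, -1)
    rw [L.apply_prod_real] at h2 h4
    simp only at h1 h2 h3 h4
    rw [show L (0, 1) = p by linarith]
    linarith
  rcases le_total (p₁ * z₀.2 - H p₁ * z₀.1) (p₂ * z₀.2 - H p₂ * z₀.1) with h | h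
  · exact key p₂ (by rw [hu.self_of_nhds, max_eq_right h]) (hu.mono fun z hz => by
      rw [hz]; exact le_max_right _ _)
  · exact key p₁ (by rw [hu.self_of_nhds, max_eq_left h]) (hu.mono fun z hz => by
      rw [hz]; exact le_max_left _ _)

/-- The maximum of two affine solutions is a supersolution. -/
lemma max_affine_super (hH : ConcaveOn ℝ (Icc 0 R) H) (hp₁ : p₁ ∈ Icc 0 R) (hp₂ : p₂ ∈ Icc 0 R)
    (hp : p₁ ≤ p₂)
    (hu : ∀ᶠ z in 𝓝 z₀, u z = max (p₁ * z.2 - H p₁ * z.1) (p₂ * z.2 - H p₂ * z.1))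
    (hΦ : HasFDerivAt Φ L z₀) (hmin : ∀ᶠ z in 𝓝 z₀, u z₀ - Φ z₀ ≤ u z - Φ z) :
    0 ≤ L (1, 0) + H (L (0, 1)) := by
  have key : ∀ p, u z₀ = p * z₀.2 - H p * z₀.1 →
      (∀ᶠ z in 𝓝 z₀, u z = p * z.2 - H p * z.1) → 0 ≤ L (1, 0) + H (L (0, 1)) := by
    intro p h0 hle
    have hdir : ∀ v : ℝ × ℝ, L v ≤ p * v.2 - H p * v.1 := by
      intro v
      refine hΦ.le_of_touch (u := fun z => p * z.2 - H p * z.1) (by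
        filter_upwards [hmin, hle] with z h1 h2
        linarith) v (Eventually.of_forall fun s => by simp; linarith)
    have h1 := hdir (1, 0)
    have h2 := hdir (-1, 0)
    have h3 := hdir (0, 1)
    have h4 := hdir (0, -1)
    rw [L.apply_prod_real] at h2 h4
    simp only at h1 h2 h3 h4
    rw [show L (0, 1) = p by linarith]
    linarith
  have hc : ∀ p : ℝ, ContinuousAt (fun z : ℝ × ℝ => p * z.2 - H p * z.1) z₀ := fun p => by
    fun_prop
  rcases lt_trichotomy (p₁ * z₀.2 - H p₁ * z₀.1) (p₂ * z₀.2 - H p₂ * z₀.1) with h | h | h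
  · exact key p₂ (by rw [hu.self_of_nhds, max_eq_right h.le]) (by
      filter_upwards [hu, (hc p₁).eventually_lt (hc p₂) h] with z hz hlt
      rw [hz, max_eq_right hlt.le])
  · have hu0 := hu.self_of_nhds
    have hdir : ∀ v : ℝ × ℝ, L v ≤ max (p₁ * v.2 - H p₁ * v.1) (p₂ * v.2 - H p₂ * v.1) := by
      intro v
      refine hΦ.le_of_touch
        (u := fun z => max (p₁ * z.2 - H p₁ * z.1) (p₂ * z.2 - H p₂ * z.1)) (by
          filter_upwards [hmin, hu] with z h1 h2
          rw [← h2, ← hu0]; exact h1) v ?_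
      filter_upwards [self_mem_nhdsWithin] with s hs
      have hs : 0 < s := hs
      have h1 := le_max_left (p₁ * v.2 - H p₁ * v.1) (p₂ * v.2 - H p₂ * v.1)
      have h2 := le_max_right (p₁ * v.2 - H p₁ * v.1) (p₂ * v.2 - H p₂ * v.1)
      rw [h, max_self, sub_le_iff_le_add]
      simp only [Prod.fst_add, Prod.snd_add, Prod.smul_fst, Prod.smul_snd, smul_eq_mul]
      refine max_le ?_ ?_ <;> nlinarith
    rcases hp.eq_or_lt with rfl | hlt
    · exact key p₁ (by rw [hu0, max_self]) (hu.mono fun z hz => by rw [hz, max_self])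
    · have h1 := hdir (p₂ - p₁, H p₂ - H p₁)
      have h2 := hdir (-(p₂ - p₁), -(H p₂ - H p₁))
      have h3 := hdir (0, 1)
      have h4 := hdir (0, -1)
      rw [L.apply_prod_real] at h1 h2 h4
      simp only at h1 h2 h3 h4
      set τ := L (1, 0)
      set q := L (0, 1)
      have hq2 : q ≤ p₂ := by
        rw [max_eq_right (by linarith)] at h3; linarith
      have hq1 : p₁ ≤ q := by
        rw [max_eq_left (by linarith)] at h4; linarith
      rw [show p₁ * (H p₂ - H p₁) - H p₁ * (p₂ - p₁) =
        p₂ * (H p₂ - H p₁) - H p₂ * (p₂ - p₁) by ring, max_self] at h1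
      rw [show p₁ * -(H p₂ - H p₁) - H p₁ * -(p₂ - p₁) =
        p₂ * -(H p₂ - H p₁) - H p₂ * -(p₂ - p₁) by ring, max_self] at h2
      have hd : 0 < p₂ - p₁ := by linarith
      have hconc := hH.2 hp₁ hp₂
        (div_nonneg (by linarith) hd.le : 0 ≤ (p₂ - q) / (p₂ - p₁))
        (div_nonneg (by linarith) hd.le : 0 ≤ (q - p₁) / (p₂ - p₁))
        (by field_simp; ring)
      have hqe : (p₂ - q) / (p₂ - p₁) * p₁ + (q - p₁) / (p₂ - p₁) * p₂ = q := by
        field_simp; ring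
      simp only [smul_eq_mul] at hconc
      rw [hqe] at hconc
      have h5 : (p₂ - p₁) * ((p₂ - q) / (p₂ - p₁) * H p₁ + (q - p₁) / (p₂ - p₁) * H p₂) =
          (p₂ - q) * H p₁ + (q - p₁) * H p₂ := by
        field_simp
      have h6 : 0 ≤ (p₂ - p₁) * (τ + H q) := by nlinarith
      exact nonneg_of_mul_nonneg_right h6 hd
  · exact key p₁ (by rw [hu.self_of_nhds, max_eq_left h.le]) (by
      filter_upwards [hu, (hc p₂).eventually_lt (hc p₁) h] with z hz hlt
      rw [hz, max_eq_left hlt.le])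

end MaxAffine

/-- The solution with data `pwLin pl pr` which, near the junction, has slopes `ql`, `qr` and
flux `lam`. -/
def fanSol (Hl Hr : ℝ → ℝ) (pl ql pr qr lam t x : ℝ) : ℝ :=
  max (pl * min x 0 - Hl pl * t) (ql * min x 0 - lam * t) +
    max (pr * max x 0 - Hr pr * t) (qr * max x 0 - lam * t) + lam * t

section FanSol

variable {Hl Hr : ℝ → ℝ} {Rl Rr pl ql pr qr lam : ℝ}

lemma fanSol_of_nonpos (hr : lam ≤ Hr pr) {t x : ℝ} (ht : 0 ≤ t) (hx : x ≤ 0) :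
    fanSol Hl Hr pl ql pr qr lam t x = max (pl * x - Hl pl * t) (ql * x - lam * t) := by
  have : -(Hr pr * t) ≤ -(lam * t) := by nlinarith
  simp [fanSol, hx, this]

lemma fanSol_of_nonneg (hl : lam ≤ Hl pl) {t x : ℝ} (ht : 0 ≤ t) (hx : 0 ≤ x) :
    fanSol Hl Hr pl ql pr qr lam t x = max (pr * x - Hr pr * t) (qr * x - lam * t) := by
  have : -(Hl pl * t) ≤ -(lam * t) := by nlinarith
  simp [fanSol, hx, this]

lemma max_affine_increment {p q a b R x y : ℝ} (hp : p ∈ Icc 0 R) (hq : q ∈ Icc 0 R)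
    (hxy : x ≤ y) :
    0 ≤ max (p * y - a) (q * y - b) - max (p * x - a) (q * x - b) ∧
      max (p * y - a) (q * y - b) - max (p * x - a) (q * x - b) ≤ R * (y - x) := by
  have h1 : p * x ≤ p * y := mul_le_mul_of_nonneg_left hxy hp.1
  have h2 : q * x ≤ q * y := mul_le_mul_of_nonneg_left hxy hq.1
  have h3 : p * (y - x) ≤ R * (y - x) := mul_le_mul_of_nonneg_right hp.2 (by linarith)
  have h4 : q * (y - x) ≤ R * (y - x) := mul_le_mul_of_nonneg_right hq.2 (by linarith)
  constructor
  · rw [sub_nonneg]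
    exact max_le_max (by linarith) (by linarith)
  · rw [sub_le_iff_le_add]
    refine max_le ?_ ?_
    · linarith [le_max_left (p * x - a) (q * x - b)]
    · linarith [le_max_right (p * x - a) (q * x - b)]

lemma eventually_max_affine_eq {p q a lam t : ℝ} (ht : 0 < t) (h : (q = p ∧ a = lam) ∨ lam < a) :
    ∀ᶠ z : ℝ × ℝ in 𝓝 (t, (0 : ℝ)),
      max (p * z.2 - a * z.1) (q * z.2 - lam * z.1) = q * z.2 - lam * z.1 := by
  rcases h with ⟨rfl, rfl⟩ | h
  · simp
  · have h1 : ContinuousAt (fun z : ℝ × ℝ => p * z.2 - a * z.1) (t, 0) := by fun_prop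
    have h2 : ContinuousAt (fun z : ℝ × ℝ => q * z.2 - lam * z.1) (t, 0) := by fun_prop
    filter_upwards [h1.eventually_lt h2 (by simpa using mul_lt_mul_of_pos_right h ht)] with z hz
    exact max_eq_right hz.le

/-- `fanSol` is a flux-limited solution for every flux limiter `A ≥ lam`, provided one of the
two inner slopes lies on the branch of outgoing characteristics. -/
lemma flSol_fanSol (hHl : Continuous Hl) (hHr : Continuous Hr)
    (hHlc : ConcaveOn ℝ (Icc 0 Rl) Hl) (hHrc : ConcaveOn ℝ (Icc 0 Rr) Hr)
    (hpl : pl ∈ Icc 0 Rl) (hql : ql ∈ Icc 0 Rl) (hpr : pr ∈ Icc 0 Rr) (hqr : qr ∈ Icc 0 Rr)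
    (hl : pl ≤ ql) (hr : qr ≤ pr) (hHql : Hl ql = lam) (hHqr : Hr qr = lam)
    (hl' : ql = pl ∨ lam < Hl pl) (hr' : qr = pr ∨ lam < Hr pr)
    {A : ℝ} (hlam : 0 ≤ lam) (hA : lam ≤ A)
    (hbranch : (∀ y ∈ Icc 0 ql, Hl y ≤ lam) ∨ ∀ y ∈ Icc qr Rr, Hr y ≤ lam) :
    FLSol Hl Hr Rl Rr A (pwLin pl pr) (fanSol Hl Hr pl ql pr qr lam) := by
  have hll : lam ≤ Hl pl := by rcases hl' with h | h; exacts [by rw [← hHql, h], h.le]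
  have hrr : lam ≤ Hr pr := by rcases hr' with h | h; exacts [by rw [← hHqr, h], h.le]
  have hpos : ∀ {t : ℝ} (x : ℝ), 0 < t → ∀ᶠ z : ℝ × ℝ in 𝓝 (t, x), 0 < z.1 :=
    fun {t} x ht => (continuous_fst.tendsto (t, x)).eventually (lt_mem_nhds ht)
  have hleft : ∀ t x : ℝ, 0 < t → x < 0 → ∀ᶠ z : ℝ × ℝ in 𝓝 (t, x),
      fanSol Hl Hr pl ql pr qr lam z.1 z.2 =
        max (pl * z.2 - Hl pl * z.1) (ql * z.2 - Hl ql * z.1) := by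
    intro t x ht hx
    filter_upwards [hpos x ht, eventually_snd_neg t hx] with z h1 h2
    rw [fanSol_of_nonpos hrr h1.le h2.le, hHql]
  have hright : ∀ t x : ℝ, 0 < t → 0 < x → ∀ᶠ z : ℝ × ℝ in 𝓝 (t, x),
      fanSol Hl Hr pl ql pr qr lam z.1 z.2 =
        max (qr * z.2 - Hr qr * z.1) (pr * z.2 - Hr pr * z.1) := by
    intro t x ht hx
    filter_upwards [hpos x ht, eventually_snd_pos t hx] with z h1 h2
    rw [fanSol_of_nonneg hll h1.le h2.le, hHqr, max_comm]
  have hjl : ∀ t : ℝ, 0 < t → ∀ᶠ z : ℝ × ℝ in 𝓝 (t, (0 : ℝ)), z.2 ≤ 0 →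
      fanSol Hl Hr pl ql pr qr lam z.1 z.2 = ql * z.2 - lam * z.1 := by
    intro t ht
    filter_upwards [hpos 0 ht, eventually_max_affine_eq ht
      (hl'.imp_left fun h => ⟨h, by rw [← hHql, h]⟩)] with z h1 h2 h3
    rw [fanSol_of_nonpos hrr h1.le h3, h2]
  have hjr : ∀ t : ℝ, 0 < t → ∀ᶠ z : ℝ × ℝ in 𝓝 (t, (0 : ℝ)), 0 ≤ z.2 →
      fanSol Hl Hr pl ql pr qr lam z.1 z.2 = qr * z.2 - lam * z.1 := by
    intro t ht
    filter_upwards [hpos 0 ht, eventually_max_affine_eq ht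
      (hr'.imp_left fun h => ⟨h, by rw [← hHqr, h]⟩)] with z h1 h2 h3
    rw [fanSol_of_nonneg hll h1.le h3, h2]
  have hval : ∀ t : ℝ, 0 < t → fanSol Hl Hr pl ql pr qr lam t 0 = -(lam * t) := by
    intro t ht
    have := (hjl t ht).self_of_nhds le_rfl
    simpa using this
  have htime : ∀ t : ℝ, ∀ P : ℝ × ℝ → Prop, (∀ᶠ z in 𝓝 (t, (0 : ℝ)), P z) →
      ∀ᶠ s in 𝓝 t, P (s, 0) := fun t P h =>
    (Continuous.prodMk_left (0 : ℝ)).continuousAt.eventually h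
  refine FLSol.of_touch ?_ ?_ ?_ ?_ ?_ ?_ ?_ ?_ ?_
  · exact Continuous.continuousOn (by unfold fanSol; fun_prop)
  · intro t ht
    refine ⟨fun x y hxy hy => ?_, fun x y hx hxy => ?_⟩
    · rw [fanSol_of_nonpos hrr ht hy, fanSol_of_nonpos hrr ht (hxy.trans hy)]
      exact max_affine_increment hpl hql hxy
    · rw [fanSol_of_nonneg hll ht hx, fanSol_of_nonneg hll ht (hx.trans hxy)]
      exact max_affine_increment hpr hqr hxy
  · intro x
    rcases le_total x 0 with hx | hx
    · rw [fanSol_of_nonpos hrr le_rfl hx, pwLin_of_nonpos hx, max_eq_left (by nlinarith)]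
      ring
    · rw [fanSol_of_nonneg hll le_rfl hx, pwLin_of_nonneg hx, max_eq_left (by nlinarith)]
      ring
  · intro t x ht hx Φ L hΦ hmax
    exact max_affine_sub (hleft t x ht hx) hΦ hmax
  · intro t x ht hx Φ L hΦ hmin
    exact max_affine_super hHlc hpl hql hl (hleft t x ht hx) hΦ hmin
  · intro t x ht hx Φ L hΦ hmax
    exact max_affine_sub (hright t x ht hx) hΦ hmax
  · intro t x ht hx Φ L hΦ hmin
    exact max_affine_super hHrc hqr hpr hr (hright t x ht hx) hΦ hmin
  · intro t ht Φl Φr Ll Lr hΦl hΦr _ hmaxl hmaxr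
    have ht1 : Ll (1, 0) ≤ -lam := by
      refine hΦl.hasDerivAt_fst.le_of_left ?_
      have h1 := htime t _ hmaxl
      filter_upwards [nhdsWithin_le_nhds h1, nhdsWithin_le_nhds (lt_mem_nhds ht)] with s h2 h3
      have := h2 le_rfl
      simp only [hval t ht, hval s h3] at this
      linarith
    have hl1 : Ll (0, 1) ≤ ql := by
      refine hΦl.hasDerivAt_snd.le_of_left ?_
      filter_upwards [nhdsWithin_le_nhds (eventually_nhds_prodMk_right hmaxl),
        nhdsWithin_le_nhds (eventually_nhds_prodMk_right (hjl t ht)), self_mem_nhdsWithin]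
        with y h1 h2 h3
      have h1 := h1 (le_of_lt h3)
      have h2 := h2 (le_of_lt h3)
      simp only [hval t ht] at h1 h2
      linarith
    have hr1 : qr ≤ Lr (0, 1) := by
      refine hΦr.hasDerivAt_snd.ge_of_right ?_
      filter_upwards [nhdsWithin_le_nhds (eventually_nhds_prodMk_right hmaxr),
        nhdsWithin_le_nhds (eventually_nhds_prodMk_right (hjr t ht)), self_mem_nhdsWithin]
        with y h1 h2 h3
      have h1 := h1 (le_of_lt h3)
      have h2 := h2 (le_of_lt h3)
      simp only [hval t ht] at h1 h2
      linarith
    have : min (Hplus Hl (Ll (0, 1))) (Hminus Hr Rr (Lr (0, 1))) ≤ lam := by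
      rcases hbranch with h | h
      · exact (min_le_left _ _).trans
          (Hplus_le hlam fun y hy => h y ⟨hy.1, hy.2.trans hl1⟩)
      · exact (min_le_right _ _).trans
          (Hminus_le hlam fun y hy => h y ⟨hr1.trans hy.1, hy.2⟩)
    linarith [min_le_right A (min (Hplus Hl (Ll (0, 1))) (Hminus Hr Rr (Lr (0, 1))))]
  · intro t ht Φl Φr Ll Lr hΦl hΦr _ hminl hminr
    have ht1 : -lam ≤ Ll (1, 0) := by
      refine hΦl.hasDerivAt_fst.ge_of_left ?_
      have h1 := htime t _ hminl
      filter_upwards [nhdsWithin_le_nhds h1, nhdsWithin_le_nhds (lt_mem_nhds ht)] with s h2 h3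
      have := h2 le_rfl
      simp only [hval t ht, hval s h3] at this
      linarith
    have hl1 : ql ≤ Ll (0, 1) := by
      refine hΦl.hasDerivAt_snd.ge_of_left ?_
      filter_upwards [nhdsWithin_le_nhds (eventually_nhds_prodMk_right hminl),
        nhdsWithin_le_nhds (eventually_nhds_prodMk_right (hjl t ht)), self_mem_nhdsWithin]
        with y h1 h2 h3
      have h1 := h1 (le_of_lt h3)
      have h2 := h2 (le_of_lt h3)
      simp only [hval t ht] at h1 h2
      linarith
    have hr1 : Lr (0, 1) ≤ qr := by
      refine hΦr.hasDerivAt_snd.le_of_right ?_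
      filter_upwards [nhdsWithin_le_nhds (eventually_nhds_prodMk_right hminr),
        nhdsWithin_le_nhds (eventually_nhds_prodMk_right (hjr t ht)), self_mem_nhdsWithin]
        with y h1 h2 h3
      have h1 := h1 (le_of_lt h3)
      have h2 := h2 (le_of_lt h3)
      simp only [hval t ht] at h1 h2
      linarith
    have h1 : lam ≤ Hplus Hl (Ll (0, 1)) := hHql ▸ le_Hplus hHl ⟨hql.1, hl1⟩
    have h2 : lam ≤ Hminus Hr Rr (Lr (0, 1)) := hHqr ▸ le_Hminus hHr ⟨hr1, hqr.2⟩
    linarith [le_min hA (le_min h1 h2)]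

end FanSol

/-! ### Concave Hamiltonians vanishing at the endpoints -/

/-- `H` is continuous and concave on `[0, R]`, lies below its tangents, vanishes at the endpoints
and attains its maximum over `[0, R]` at `m`. -/
structure Bell (R : ℝ) (H : ℝ → ℝ) (m : ℝ) : Prop where
  mem : m ∈ Icc 0 R
  continuous : Continuous H
  concave : ConcaveOn ℝ (Icc 0 R) H
  tangent : ∀ p ∈ Icc 0 R, ∀ q ∈ Icc 0 R, H q ≤ H p + deriv H p * (q - p)
  zero_left : H 0 = 0
  zero_right : H R = 0
  le_max : ∀ y ∈ Icc 0 R, H y ≤ H m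

lemma exists_bell {R : ℝ} {H : ℝ → ℝ} (hR : 0 ≤ R) (hH : ContDiff ℝ 1 H)
    (hc : ConcaveOn ℝ (Icc 0 R) H) (h0 : H 0 = 0) (h1 : H R = 0) : ∃ m, Bell R H m := by
  obtain ⟨m, hm, hmax⟩ := isCompact_Icc.exists_isMaxOn ⟨0, left_mem_Icc.2 hR⟩
    hH.continuous.continuousOn
  refine ⟨m, hm, hH.continuous, hc, fun p hp q hq => ?_, h0, h1, hmax⟩
  have hd : HasDerivAt H (deriv H p) p := (hH.differentiable one_ne_zero p).hasDerivAt
  rcases lt_trichotomy p q with h | rfl | h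
  · have := hc.slope_le_of_hasDerivAt hp hq h hd
    rw [slope_def_field, div_le_iff₀ (by linarith)] at this
    linarith
  · simp
  · have := hc.le_slope_of_hasDerivAt hq hp h hd
    rw [slope_def_field, le_div_iff₀ (by linarith)] at this
    linarith

namespace Bell

variable {R : ℝ} {H : ℝ → ℝ} {m : ℝ}

lemma min_le (hB : Bell R H m) {x y z : ℝ} (hx : 0 ≤ x) (hy : y ≤ R) (hxz : x ≤ z)
    (hzy : z ≤ y) : min (H x) (H y) ≤ H z :=
  hB.concave.ge_on_segment ⟨hx, hxz.trans (hzy.trans hy)⟩ ⟨hx.trans (hxz.trans hzy), hy⟩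
    (Icc_subset_segment ⟨hxz, hzy⟩)

lemma nonneg (hB : Bell R H m) {z : ℝ} (hz : z ∈ Icc 0 R) : 0 ≤ H z := by
  have := hB.min_le le_rfl le_rfl hz.1 hz.2
  rwa [hB.zero_left, hB.zero_right, min_self] at this

lemma le_of_le_max (hB : Bell R H m) {y z : ℝ} (hy : 0 ≤ y) (hyz : y ≤ z) (hz : z ≤ m) :
    H y ≤ H z := by
  have := hB.min_le hy hB.mem.2 hyz hz
  rwa [min_eq_left (hB.le_max y ⟨hy, hyz.trans (hz.trans hB.mem.2)⟩)] at this

lemma le_of_max_le (hB : Bell R H m) {y z : ℝ} (hy : m ≤ y) (hyz : y ≤ z) (hz : z ≤ R) :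
    H z ≤ H y := by
  have := hB.min_le hB.mem.1 hz hy hyz
  rwa [min_eq_right (hB.le_max z ⟨hB.mem.1.trans (hy.trans hyz), hz⟩)] at this

lemma sSup_eq (hB : Bell R H m) : sSup (H '' Icc 0 R) = H m :=
  (IsGreatest.csSup_eq ⟨mem_image_of_mem H hB.mem, forall_mem_image.2 hB.le_max⟩)

lemma exists_right (hB : Bell R H m) {p f : ℝ} (hp : p ∈ Icc 0 R) (h0 : 0 ≤ f) (hf : f ≤ H p) :
    ∃ q ∈ Icc p R, H q = f := by
  have := intermediate_value_Icc' hp.2 hB.continuous.continuousOn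
  exact this ⟨by rwa [hB.zero_right], hf⟩

lemma exists_left (hB : Bell R H m) {p f : ℝ} (hp : p ∈ Icc 0 R) (h0 : 0 ≤ f) (hf : f ≤ H p) :
    ∃ q ∈ Icc 0 p, H q = f := by
  have := intermediate_value_Icc hp.1 hB.continuous.continuousOn
  exact this ⟨by rwa [hB.zero_left], hf⟩

end Bell

lemma Amax_eq {Hl Hr : ℝ → ℝ} {Rl Rr ml mr : ℝ} (hl : Bell Rl Hl ml) (hr : Bell Rr Hr mr) :
    Amax Hl Hr Rl Rr = min (Hl ml) (Hr mr) := by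
  rw [Amax, hl.sSup_eq, hr.sSup_eq]

/-! ### Transport of affine profiles away from the junction -/

/-- A local semigroup which coincides, away from the junction and for short times, with the
flux-limited solutions of limiter `Amax`. -/
structure JunctionSemigroup (Hl Hr : ℝ → ℝ) (Rl Rr ml mr C0 : ℝ) (S : ℝ → (ℝ → ℝ) → (ℝ → ℝ)) :
    Prop extends LocalSemigroup Rl Rr C0 S where
  left : Bell Rl Hl ml
  right : Bell Rr Hr mr
  eq_off : ∀ u0, LipClass Rl Rr u0 → ∀ ubar : ℝ → ℝ → ℝ,
    FLSol Hl Hr Rl Rr (Amax Hl Hr Rl Rr) u0 ubar →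
    ∀ x : ℝ, x ≠ 0 → ∀ t : ℝ, 0 < t → t < C0⁻¹ * |x| → S t u0 x = ubar t x

lemma eventually_max_affine_short {p q a b x : ℝ} (h : (q = p ∧ a = b) ∨ q * x < p * x) :
    ∀ᶠ t in 𝓝[>] (0 : ℝ), max (p * x - a * t) (q * x - b * t) = p * x - a * t := by
  rcases h with ⟨rfl, rfl⟩ | h
  · simp
  · have h1 : ContinuousAt (fun t : ℝ => p * x - a * t) 0 := by fun_prop
    have h2 : ContinuousAt (fun t : ℝ => q * x - b * t) 0 := by fun_prop
    filter_upwards [nhdsWithin_le_nhds (h2.eventually_lt h1 (by simpa using h))] with t ht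
    exact max_eq_left ht.le

namespace JunctionSemigroup

variable {Hl Hr : ℝ → ℝ} {Rl Rr ml mr C0 : ℝ} {S : ℝ → (ℝ → ℝ) → (ℝ → ℝ)}

lemma Amax_nonneg (hS : JunctionSemigroup Hl Hr Rl Rr ml mr C0 S) : 0 ≤ Amax Hl Hr Rl Rr := by
  rw [Amax_eq hS.left hS.right]
  exact le_min (hS.left.nonneg hS.left.mem) (hS.right.nonneg hS.right.mem)

lemma Amax_le_left (hS : JunctionSemigroup Hl Hr Rl Rr ml mr C0 S) :
    Amax Hl Hr Rl Rr ≤ Hl ml := by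
  rw [Amax_eq hS.left hS.right]; exact min_le_left _ _

lemma Amax_le_right (hS : JunctionSemigroup Hl Hr Rl Rr ml mr C0 S) :
    Amax Hl Hr Rl Rr ≤ Hr mr := by
  rw [Amax_eq hS.left hS.right]; exact min_le_right _ _

lemma eventually_lt_cone (hS : JunctionSemigroup Hl Hr Rl Rr ml mr C0 S) {x : ℝ} (hx : x ≠ 0) :
    ∀ᶠ t in 𝓝[>] (0 : ℝ), t < C0⁻¹ * |x| := by
  have hC := hS.speed_pos
  exact nhdsWithin_le_nhds (Iio_mem_nhds (by positivity))

lemma exists_transport_left (hS : JunctionSemigroup Hl Hr Rl Rr ml mr C0 S) {p : ℝ}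
    (hp : p ∈ Icc 0 Rl) {x : ℝ} (hx : x < 0) : ∃ q ∈ Icc 0 Rr,
      ∀ᶠ h in 𝓝[>] (0 : ℝ), S h (pwLin p q) x = p * x - h * Hl p := by
  set lam := min (Hl p) (Amax Hl Hr Rl Rr) with hlam
  have hlam0 : 0 ≤ lam := le_min (hS.left.nonneg hp) hS.Amax_nonneg
  obtain ⟨qr, hqr, hHqr⟩ := hS.right.exists_right hS.right.mem hlam0
    ((min_le_right _ _).trans hS.Amax_le_right)
  have hqr' : qr ∈ Icc 0 Rr := ⟨hS.right.mem.1.trans hqr.1, hqr.2⟩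
  obtain ⟨ql, hql, hHql, hql'⟩ : ∃ ql ∈ Icc p Rl, Hl ql = lam ∧ (ql = p ∨ lam < Hl p) := by
    rcases le_or_gt (Hl p) (Amax Hl Hr Rl Rr) with h | h
    · exact ⟨p, ⟨le_rfl, hp.2⟩, (min_eq_left h).symm, Or.inl rfl⟩
    · obtain ⟨ql, hql, hHql⟩ := hS.left.exists_right hp hlam0 (min_le_left _ _)
      exact ⟨ql, hql, hHql, Or.inr ((min_le_right _ _).trans_lt h)⟩
  have hsol := flSol_fanSol (A := Amax Hl Hr Rl Rr) hS.left.continuous hS.right.continuous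
    hS.left.concave hS.right.concave hp ⟨hp.1.trans hql.1, hql.2⟩ hqr' hqr' hql.1 le_rfl hHql hHqr
    hql' (Or.inl rfl) hlam0 (min_le_right _ _)
    (Or.inr fun y hy => hHqr ▸ hS.right.le_of_max_le hqr.1 hy.1 hy.2)
  refine ⟨qr, hqr', ?_⟩
  have hshort : (ql = p ∧ Hl p = lam) ∨ ql * x < p * x := by
    rcases eq_or_ne ql p with h | h
    · exact Or.inl ⟨h, by rw [← hHql, h]⟩
    · exact Or.inr (mul_lt_mul_of_neg_right (lt_of_le_of_ne hql.1 h.symm) hx)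
  filter_upwards [eventually_max_affine_short hshort, hS.eventually_lt_cone hx.ne,
    self_mem_nhdsWithin] with h h1 h2 h3
  have h3 : 0 < h := h3
  rw [hS.eq_off _ (lipClass_pwLin hp hqr') _ hsol x hx.ne h h3 h2,
    fanSol_of_nonpos hHqr.ge h3.le hx.le, h1]
  ring

lemma exists_transport_right (hS : JunctionSemigroup Hl Hr Rl Rr ml mr C0 S) {p : ℝ}
    (hp : p ∈ Icc 0 Rr) {x : ℝ} (hx : 0 < x) : ∃ q ∈ Icc 0 Rl,
      ∀ᶠ h in 𝓝[>] (0 : ℝ), S h (pwLin q p) x = p * x - h * Hr p := by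
  set lam := min (Hr p) (Amax Hl Hr Rl Rr) with hlam
  have hlam0 : 0 ≤ lam := le_min (hS.right.nonneg hp) hS.Amax_nonneg
  obtain ⟨ql, hql, hHql⟩ := hS.left.exists_left hS.left.mem hlam0
    ((min_le_right _ _).trans hS.Amax_le_left)
  have hql' : ql ∈ Icc 0 Rl := ⟨hql.1, hql.2.trans hS.left.mem.2⟩
  obtain ⟨qr, hqr, hHqr, hqr'⟩ : ∃ qr ∈ Icc 0 p, Hr qr = lam ∧ (qr = p ∨ lam < Hr p) := by
    rcases le_or_gt (Hr p) (Amax Hl Hr Rl Rr) with h | h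
    · exact ⟨p, ⟨hp.1, le_rfl⟩, (min_eq_left h).symm, Or.inl rfl⟩
    · obtain ⟨qr, hqr, hHqr⟩ := hS.right.exists_left hp hlam0 (min_le_left _ _)
      exact ⟨qr, hqr, hHqr, Or.inr ((min_le_right _ _).trans_lt h)⟩
  have hsol := flSol_fanSol (A := Amax Hl Hr Rl Rr) hS.left.continuous hS.right.continuous
    hS.left.concave hS.right.concave hql' hql' hp ⟨hqr.1, hqr.2.trans hp.2⟩ le_rfl hqr.2 hHql hHqr
    (Or.inl rfl) hqr' hlam0 (min_le_right _ _)
    (Or.inl fun y hy => hHql ▸ hS.left.le_of_le_max hy.1 hy.2 hql.2)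
  refine ⟨ql, hql', ?_⟩
  have hshort : (qr = p ∧ Hr p = lam) ∨ qr * x < p * x := by
    rcases eq_or_ne qr p with h | h
    · exact Or.inl ⟨h, by rw [← hHqr, h]⟩
    · exact Or.inr (mul_lt_mul_of_pos_right (lt_of_le_of_ne hqr.2 h) hx)
  filter_upwards [eventually_max_affine_short hshort, hS.eventually_lt_cone hx.ne',
    self_mem_nhdsWithin] with h h1 h2 h3
  have h3 : 0 < h := h3
  rw [hS.eq_off _ (lipClass_pwLin hql' hp) _ hsol x hx.ne' h h3 h2,
    fanSol_of_nonneg hHql.ge h3.le hx.le, h1]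
  ring

/-- Locality: data agreeing near `x` have the same short time evolution at `x`. -/
lemma eventually_eq_of_eventuallyEq (hS : JunctionSemigroup Hl Hr Rl Rr ml mr C0 S)
    {u v : ℝ → ℝ} (hu : LipClass Rl Rr u) (hv : LipClass Rl Rr v) {x : ℝ}
    (huv : ∀ᶠ y in 𝓝 x, u y = v y) : ∀ᶠ h in 𝓝[>] (0 : ℝ), S h u x = S h v x := by
  have huv' : ∀ᶠ z : ℝ × ℝ in 𝓝 ((0 : ℝ), x), u z.2 = v z.2 :=
    (continuous_snd.tendsto ((0 : ℝ), x)).eventually huv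
  filter_upwards [eventually_cone hS.speed_pos huv', self_mem_nhdsWithin] with h h1 h2
  have h2 : 0 < h := h2
  refine le_antisymm ?_ ?_
  · simpa using hS.comparison u v hu hv h x 0 h2.le fun y hy => by simp [h1 y hy]
  · simpa using hS.comparison v u hv hu h x 0 h2.le fun y hy => by simp [h1 y hy]

lemma transport_left (hS : JunctionSemigroup Hl Hr Rl Rr ml mr C0 S) {p q : ℝ}
    (hp : p ∈ Icc 0 Rl) (hq : q ∈ Icc 0 Rr) {x : ℝ} (hx : x < 0) :
    ∀ᶠ h in 𝓝[>] (0 : ℝ), S h (pwLin p q) x = p * x - h * Hl p := by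
  obtain ⟨q', hq', h⟩ := hS.exists_transport_left hp hx
  have hloc : ∀ᶠ y in 𝓝 x, pwLin p q y = pwLin p q' y := by
    filter_upwards [Iio_mem_nhds hx] with y hy
    rw [pwLin_of_nonpos (le_of_lt hy), pwLin_of_nonpos (le_of_lt hy)]
  filter_upwards [h, hS.eventually_eq_of_eventuallyEq (lipClass_pwLin hp hq)
    (lipClass_pwLin hp hq') hloc] with h h1 h2
  rw [h2, h1]

lemma transport_right (hS : JunctionSemigroup Hl Hr Rl Rr ml mr C0 S) {p q : ℝ}
    (hp : p ∈ Icc 0 Rl) (hq : q ∈ Icc 0 Rr) {x : ℝ} (hx : 0 < x) :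
    ∀ᶠ h in 𝓝[>] (0 : ℝ), S h (pwLin p q) x = q * x - h * Hr q := by
  obtain ⟨p', hp', h⟩ := hS.exists_transport_right hq hx
  have hloc : ∀ᶠ y in 𝓝 x, pwLin p q y = pwLin p' q y := by
    filter_upwards [Ioi_mem_nhds hx] with y hy
    rw [pwLin_of_nonneg (le_of_lt hy), pwLin_of_nonneg (le_of_lt hy)]
  filter_upwards [h, hS.eventually_eq_of_eventuallyEq (lipClass_pwLin hp hq)
    (lipClass_pwLin hp' hq) hloc] with h h1 h2
  rw [h2, h1]

lemma locallyLinear_left (hS : JunctionSemigroup Hl Hr Rl Rr ml mr C0 S) {x : ℝ} (hx : x < 0) :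
    LocallyLinear Rl Rr S x Rl Hl := by
  refine ⟨fun v hv => ?_, fun p hp => ?_⟩
  · filter_upwards [Iio_mem_nhds hx] with y hy
    refine ⟨fun h => hv.1 x y h (le_of_lt hy), fun h => ?_⟩
    have := hv.1 y x h hx.le
    constructor <;> linarith
  · have h0 : (0 : ℝ) ∈ Icc 0 Rr := ⟨le_rfl, hS.right.mem.1.trans hS.right.mem.2⟩
    refine ⟨pwLin p 0, lipClass_pwLin hp h0, ?_, ?_⟩
    · filter_upwards [Iio_mem_nhds hx] with y hy
      rw [pwLin_of_nonpos (le_of_lt hy), pwLin_of_nonpos hx.le]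
      ring
    · rw [pwLin_of_nonpos hx.le]
      exact hS.transport_left hp h0 hx

lemma locallyLinear_right (hS : JunctionSemigroup Hl Hr Rl Rr ml mr C0 S) {x : ℝ} (hx : 0 < x) :
    LocallyLinear Rl Rr S x Rr Hr := by
  refine ⟨fun v hv => ?_, fun p hp => ?_⟩
  · filter_upwards [Ioi_mem_nhds hx] with y hy
    refine ⟨fun h => hv.2 x y hx.le h, fun h => ?_⟩
    have := hv.2 y x (le_of_lt hy) h
    constructor <;> linarith
  · have h0 : (0 : ℝ) ∈ Icc 0 Rl := ⟨le_rfl, hS.left.mem.1.trans hS.left.mem.2⟩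
    refine ⟨pwLin 0 p, lipClass_pwLin h0 hp, ?_, ?_⟩
    · filter_upwards [Ioi_mem_nhds hx] with y hy
      rw [pwLin_of_nonneg (le_of_lt hy), pwLin_of_nonneg hx.le]
      ring
    · rw [pwLin_of_nonneg hx.le]
      exact hS.transport_right h0 hp hx

end JunctionSemigroup

/-! ### The flux through the junction for piecewise linear data -/

/-- The flux through the junction for the data `pwLin p q`. -/
def junctionFlux (S : ℝ → (ℝ → ℝ) → (ℝ → ℝ)) (p q : ℝ) : ℝ := -S 1 (pwLin p q) 0

namespace JunctionSemigroup

variable {Hl Hr : ℝ → ℝ} {Rl Rr ml mr C0 : ℝ} {S : ℝ → (ℝ → ℝ) → (ℝ → ℝ)} {p q : ℝ}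

lemma eq_selfSimilar (hS : JunctionSemigroup Hl Hr Rl Rr ml mr C0 S)
    (hp : p ∈ Icc 0 Rl) (hq : q ∈ Icc 0 Rr) {t : ℝ} (ht : 0 < t) (x : ℝ) :
    S t (pwLin p q) x = t * S 1 (pwLin p q) (x / t) := by
  have h := hS.scaling t t ht ht _ (lipClass_pwLin hp hq) x
  rw [div_self ht.ne', funext (pwLin_smul ht)] at h
  exact h.symm

lemma eq_junctionFlux (hS : JunctionSemigroup Hl Hr Rl Rr ml mr C0 S)
    (hp : p ∈ Icc 0 Rl) (hq : q ∈ Icc 0 Rr) {h : ℝ} (hh : 0 < h) :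
    S h (pwLin p q) 0 = -(h * junctionFlux S p q) := by
  rw [hS.eq_selfSimilar hp hq hh, zero_div, junctionFlux]
  ring

end JunctionSemigroup

/-- The derivative of the self-similar function `t ψ(x/t)`. -/
lemma HasDerivAt.exists_hasFDerivAt_selfSimilar {ψ : ℝ → ℝ} {d ξ : ℝ} (hψ : HasDerivAt ψ d ξ) :
    ∃ L : ℝ × ℝ →L[ℝ] ℝ, HasFDerivAt (fun z : ℝ × ℝ => z.1 * ψ (z.2 / z.1)) L (1, ξ) ∧
      L (1, 0) = ψ ξ - ξ * d ∧ L (0, 1) = d := by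
  have h1 : HasFDerivAt (fun z : ℝ × ℝ => z.1) (ContinuousLinearMap.fst ℝ ℝ ℝ) (1, ξ) :=
    hasFDerivAt_fst
  have h2 : HasFDerivAt (fun z : ℝ × ℝ => z.2) (ContinuousLinearMap.snd ℝ ℝ ℝ) (1, ξ) :=
    hasFDerivAt_snd
  have hinv : HasDerivAt (fun s : ℝ => s⁻¹) (-(1 ^ 2)⁻¹) 1 := hasDerivAt_inv one_ne_zero
  have h3 : HasFDerivAt (fun z : ℝ × ℝ => z.2 * z.1⁻¹) _ (1, ξ) :=
    h2.fun_mul (hinv.comp_hasFDerivAt (1, ξ) h1)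
  have hψ' : HasDerivAt ψ d ((fun z : ℝ × ℝ => z.2 * z.1⁻¹) (1, ξ)) := by simpa using hψ
  have h4 := h1.fun_mul (hψ'.comp_hasFDerivAt (1, ξ) h3)
  simp only [div_eq_mul_inv]
  refine ⟨_, h4, ?_, ?_⟩
  · simp; ring
  · simp

namespace JunctionSemigroup

variable {Hl Hr : ℝ → ℝ} {Rl Rr ml mr C0 : ℝ} {S : ℝ → (ℝ → ℝ) → (ℝ → ℝ)} {p q : ℝ}

lemma profile_super (hS : JunctionSemigroup Hl Hr Rl Rr ml mr C0 S)
    (hp : p ∈ Icc 0 Rl) (hq : q ∈ Icc 0 Rr) {ξ R : ℝ} {H : ℝ → ℝ}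
    (hloc : LocallyLinear Rl Rr S ξ R H) {ψ : ℝ → ℝ} {d : ℝ} (hψ : HasDerivAt ψ d ξ)
    (hmin : ∀ᶠ y in 𝓝 ξ, S 1 (pwLin p q) ξ - ψ ξ ≤ S 1 (pwLin p q) y - ψ y) :
    d ∈ Icc 0 R ∧ 0 ≤ S 1 (pwLin p q) ξ - ξ * d + H d := by
  set U := S 1 (pwLin p q) with hU
  obtain ⟨L, hL, hL1, hL2⟩ :=
    (hψ.add_const (U ξ - ψ ξ)).exists_hasFDerivAt_selfSimilar
  have hdiv : ContinuousAt (fun z : ℝ × ℝ => z.2 / z.1) (1, ξ) :=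
    continuousAt_snd.div continuousAt_fst one_ne_zero
  have hdiv' : Tendsto (fun z : ℝ × ℝ => z.2 / z.1) (𝓝 (1, ξ)) (𝓝 ξ) := by
    simpa [ContinuousAt] using hdiv
  have key := hloc.touch_super hS.toLocalSemigroup (lipClass_pwLin hp hq) one_pos hL (by
    filter_upwards [hdiv'.eventually hmin,
      (continuous_fst.tendsto ((1 : ℝ), ξ)).eventually (lt_mem_nhds (zero_lt_one' ℝ))]
      with z h1 h2
    rw [hS.eq_selfSimilar hp hq h2, ← hU]
    simp only [div_one, one_mul]
    nlinarith)
  rw [hL1, hL2] at key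
  refine ⟨key.1, ?_⟩
  linarith [key.2]

lemma profile_sub (hS : JunctionSemigroup Hl Hr Rl Rr ml mr C0 S)
    (hp : p ∈ Icc 0 Rl) (hq : q ∈ Icc 0 Rr) {ξ R : ℝ} {H : ℝ → ℝ}
    (hloc : LocallyLinear Rl Rr S ξ R H) {ψ : ℝ → ℝ} {d : ℝ} (hψ : HasDerivAt ψ d ξ)
    (hmax : ∀ᶠ y in 𝓝 ξ, S 1 (pwLin p q) y - ψ y ≤ S 1 (pwLin p q) ξ - ψ ξ) :
    d ∈ Icc 0 R ∧ S 1 (pwLin p q) ξ - ξ * d + H d ≤ 0 := by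
  set U := S 1 (pwLin p q) with hU
  obtain ⟨L, hL, hL1, hL2⟩ :=
    (hψ.add_const (U ξ - ψ ξ)).exists_hasFDerivAt_selfSimilar
  have hdiv : ContinuousAt (fun z : ℝ × ℝ => z.2 / z.1) (1, ξ) :=
    continuousAt_snd.div continuousAt_fst one_ne_zero
  have hdiv' : Tendsto (fun z : ℝ × ℝ => z.2 / z.1) (𝓝 (1, ξ)) (𝓝 ξ) := by
    simpa [ContinuousAt] using hdiv
  have key := hloc.touch_sub hS.toLocalSemigroup (lipClass_pwLin hp hq) one_pos hL (by
    filter_upwards [hdiv'.eventually hmax,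
      (continuous_fst.tendsto ((1 : ℝ), ξ)).eventually (lt_mem_nhds (zero_lt_one' ℝ))]
      with z h1 h2
    rw [hS.eq_selfSimilar hp hq h2, ← hU]
    simp only [div_one, one_mul]
    nlinarith)
  rw [hL1, hL2] at key
  refine ⟨key.1, ?_⟩
  linarith [key.2]

lemma profile_lipClass (hS : JunctionSemigroup Hl Hr Rl Rr ml mr C0 S)
    (hp : p ∈ Icc 0 Rl) (hq : q ∈ Icc 0 Rr) : LipClass Rl Rr (S 1 (pwLin p q)) :=
  hS.lipClass 1 _ zero_le_one (lipClass_pwLin hp hq)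

lemma halfProfile_left (hS : JunctionSemigroup Hl Hr Rl Rr ml mr C0 S)
    (hp : p ∈ Icc 0 Rl) (hq : q ∈ Icc 0 Rr) : HalfProfile 0 Rl Hl (S 1 (pwLin p q)) where
  continuousOn := (hS.profile_lipClass hp hq).continuous.continuousOn
  super _ hξ _ _ hψ hmin := hS.profile_super hp hq (hS.locallyLinear_left hξ) hψ hmin
  sub _ hξ _ _ hψ hmax := hS.profile_sub hp hq (hS.locallyLinear_left hξ) hψ hmax
  exists_differentiableAt r hr := by
    obtain ⟨ξ, h1, h2⟩ := (Measure.dense_of_ae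
      (hS.profile_lipClass hp hq).monotone.ae_differentiableAt).exists_between
      (neg_lt_zero.2 hr)
    exact ⟨ξ, h2, h1⟩

lemma halfProfile_right (hS : JunctionSemigroup Hl Hr Rl Rr ml mr C0 S)
    (hp : p ∈ Icc 0 Rl) (hq : q ∈ Icc 0 Rr) :
    HalfProfile (-Rr) 0 (fun s => Hr (-s)) (fun ξ => S 1 (pwLin p q) (-ξ)) where
  continuousOn :=
    ((hS.profile_lipClass hp hq).continuous.comp continuous_neg).continuousOn
  super ξ hξ ψ d hψ hmin := by
    have hψ' : HasDerivAt (fun y => ψ (-y)) (-d) (-ξ) := by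
      have : HasDerivAt ψ d (-(-ξ)) := by simpa using hψ
      exact (this.comp (-ξ) (hasDerivAt_neg (-ξ))).congr_deriv (by ring)
    have hneg : Tendsto (fun y : ℝ => -y) (𝓝 (-ξ)) (𝓝 ξ) := by
      simpa using (continuous_neg.tendsto (-ξ) : Tendsto _ _ (𝓝 (-(-ξ))))
    have := hS.profile_super hp hq (hS.locallyLinear_right (neg_pos.2 hξ)) hψ' (by
      filter_upwards [hneg.eventually hmin] with y hy
      simpa using hy)
    refine ⟨⟨by linarith [this.1.2], by linarith [this.1.1]⟩, ?_⟩
    linarith [this.2]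
  sub ξ hξ ψ d hψ hmax := by
    have hψ' : HasDerivAt (fun y => ψ (-y)) (-d) (-ξ) := by
      have : HasDerivAt ψ d (-(-ξ)) := by simpa using hψ
      exact (this.comp (-ξ) (hasDerivAt_neg (-ξ))).congr_deriv (by ring)
    have hneg : Tendsto (fun y : ℝ => -y) (𝓝 (-ξ)) (𝓝 ξ) := by
      simpa using (continuous_neg.tendsto (-ξ) : Tendsto _ _ (𝓝 (-(-ξ))))
    have := hS.profile_sub hp hq (hS.locallyLinear_right (neg_pos.2 hξ)) hψ' (by
      filter_upwards [hneg.eventually hmax] with y hy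
      simpa using hy)
    refine ⟨⟨by linarith [this.1.2], by linarith [this.1.1]⟩, ?_⟩
    linarith [this.2]
  exists_differentiableAt r hr := by
    obtain ⟨ξ, h1, h2⟩ := (Measure.dense_of_ae
      (hS.profile_lipClass hp hq).monotone.ae_differentiableAt).exists_between hr
    refine ⟨-ξ, ⟨by linarith [h2.2], by linarith [h2.1]⟩, ?_⟩
    have h1 : DifferentiableAt ℝ (S 1 (pwLin p q)) (-(-ξ)) := by simpa using h1
    exact h1.comp (-ξ) differentiableAt_id.neg

/-- The profile is unperturbed far to the left. -/
lemma exists_far_left (hS : JunctionSemigroup Hl Hr Rl Rr ml mr C0 S)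
    (hp : p ∈ Icc 0 Rl) (hq : q ∈ Icc 0 Rr) :
    ∃ L > 0, S 1 (pwLin p q) (-L) = p * (-L) - Hl p := by
  obtain ⟨h, h1, h2⟩ :=
    ((hS.transport_left hp hq (neg_one_lt_zero (R := ℝ))).and self_mem_nhdsWithin).exists
  have h2 : 0 < h := h2
  refine ⟨h⁻¹, inv_pos.2 h2, ?_⟩
  rw [hS.eq_selfSimilar hp hq h2, neg_div, one_div] at h1
  have : S 1 (pwLin p q) (-h⁻¹) = h⁻¹ * (p * -1 - h * Hl p) := by
    rw [← h1, inv_mul_cancel_left₀ h2.ne']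
  rw [this]
  field_simp

/-- The profile is unperturbed far to the right. -/
lemma exists_far_right (hS : JunctionSemigroup Hl Hr Rl Rr ml mr C0 S)
    (hp : p ∈ Icc 0 Rl) (hq : q ∈ Icc 0 Rr) :
    ∃ L > 0, S 1 (pwLin p q) L = q * L - Hr q := by
  obtain ⟨h, h1, h2⟩ :=
    ((hS.transport_right hp hq (zero_lt_one' ℝ)).and self_mem_nhdsWithin).exists
  have h2 : 0 < h := h2
  refine ⟨h⁻¹, inv_pos.2 h2, ?_⟩
  rw [hS.eq_selfSimilar hp hq h2, one_div] at h1
  have : S 1 (pwLin p q) h⁻¹ = h⁻¹ * (q * 1 - h * Hr q) := by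
    rw [← h1, inv_mul_cancel_left₀ h2.ne']
  rw [this]
  field_simp

end JunctionSemigroup

namespace JunctionSemigroup

variable {Hl Hr : ℝ → ℝ} {Rl Rr ml mr C0 : ℝ} {S : ℝ → (ℝ → ℝ) → (ℝ → ℝ)} {p q p' q' : ℝ}

lemma junctionFlux_mono (hS : JunctionSemigroup Hl Hr Rl Rr ml mr C0 S)
    (hp : p ∈ Icc 0 Rl) (hq : q ∈ Icc 0 Rr) (hp' : p' ∈ Icc 0 Rl) (hq' : q' ∈ Icc 0 Rr)
    (h : p ≤ p') (h' : q' ≤ q) : junctionFlux S p q ≤ junctionFlux S p' q' := by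
  have := hS.comparison _ _ (lipClass_pwLin hp' hq') (lipClass_pwLin hp hq) 1 0 0 zero_le_one
    fun y _ => by simpa using pwLin_le_pwLin h h' y
  simp only [junctionFlux]
  linarith

lemma junctionFlux_nonneg (hS : JunctionSemigroup Hl Hr Rl Rr ml mr C0 S)
    (hp : p ∈ Icc 0 Rl) (hq : q ∈ Icc 0 Rr) : 0 ≤ junctionFlux S p q :=
  (hS.halfProfile_left hp hq).neg_boundary_nonneg fun _ => hS.left.nonneg

lemma junctionFlux_le_Amax (hS : JunctionSemigroup Hl Hr Rl Rr ml mr C0 S)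
    (hp : p ∈ Icc 0 Rl) (hq : q ∈ Icc 0 Rr) : junctionFlux S p q ≤ Amax Hl Hr Rl Rr := by
  rw [Amax_eq hS.left hS.right]
  refine le_min ((hS.halfProfile_left hp hq).neg_boundary_le hS.left.le_max) ?_
  have := (hS.halfProfile_right hp hq).neg_boundary_le (M := Hr mr) fun s hs =>
    hS.right.le_max (-s) ⟨by linarith [hs.2], by linarith [hs.1]⟩
  simpa [junctionFlux] using this

lemma junctionFlux_le_left (hS : JunctionSemigroup Hl Hr Rl Rr ml mr C0 S)
    (hp : p ∈ Icc 0 Rl) (hq : q ∈ Icc 0 Rr) (hpm : p ≤ ml) : junctionFlux S p q ≤ Hl p := by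
  rcases hpm.eq_or_lt with rfl | hpm
  · exact (hS.junctionFlux_le_Amax hp hq).trans hS.Amax_le_left
  obtain ⟨L, hL, hUL⟩ := hS.exists_far_left hp hq
  have hc : 0 ≤ deriv Hl p := by
    have h1 := hS.left.tangent p hp ml hS.left.mem
    have h2 := hS.left.le_max p hp
    exact nonneg_of_mul_nonneg_left (by linarith) (sub_pos.2 hpm)
  exact (hS.halfProfile_left hp hq).neg_boundary_le_incoming hc (hS.left.tangent p hp) hL hUL

lemma tangent_right (hS : JunctionSemigroup Hl Hr Rl Rr ml mr C0 S) (hq : q ∈ Icc 0 Rr) :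
    ∀ s ∈ Icc (-Rr) 0, Hr (-s) ≤ Hr (-(-q)) + -deriv Hr q * (s - -q) := by
  intro s hs
  have := hS.right.tangent q hq (-s) ⟨by linarith [hs.2], by linarith [hs.1]⟩
  rw [neg_neg]
  linarith

lemma junctionFlux_le_right (hS : JunctionSemigroup Hl Hr Rl Rr ml mr C0 S)
    (hp : p ∈ Icc 0 Rl) (hq : q ∈ Icc 0 Rr) (hqm : mr ≤ q) : junctionFlux S p q ≤ Hr q := by
  rcases hqm.eq_or_lt with rfl | hqm
  · exact (hS.junctionFlux_le_Amax hp hq).trans hS.Amax_le_right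
  obtain ⟨L, hL, hUL⟩ := hS.exists_far_right hp hq
  have hc : 0 ≤ -deriv Hr q := by
    have h1 := hS.right.tangent q hq mr hS.right.mem
    have h2 := hS.right.le_max q hq
    exact nonneg_of_mul_nonneg_left (by linarith) (sub_pos.2 hqm)
  have := (hS.halfProfile_right hp hq).neg_boundary_le_incoming hc (hS.tangent_right hq) hL
    (by simpa using hUL)
  simpa [junctionFlux] using this

lemma exists_step (hS : JunctionSemigroup Hl Hr Rl Rr ml mr C0 S) {P : ℝ → Prop}
    (hP : ∀ᶠ y in 𝓝 (0 : ℝ), P y) : ∃ h > 0, ∀ y, |y - 0| ≤ C0 * h → P y := by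
  have hP' : ∀ᶠ z : ℝ × ℝ in 𝓝 ((0 : ℝ), (0 : ℝ)), P z.2 :=
    (continuous_snd.tendsto ((0 : ℝ), (0 : ℝ))).eventually hP
  obtain ⟨h, h1, h2⟩ := ((eventually_cone hS.speed_pos hP').and self_mem_nhdsWithin).exists
  exact ⟨h, h2, h1⟩

lemma step_junctionFlux (hS : JunctionSemigroup Hl Hr Rl Rr ml mr C0 S)
    (hp : p ∈ Icc 0 Rl) (hq : q ∈ Icc 0 Rr) {h : ℝ} (hh : 0 < h) :
    S h (S 1 (pwLin p q)) 0 = -((h + 1) * junctionFlux S p q) := by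
  rw [← hS.semigroup 1 h zero_le_one hh.le _ (lipClass_pwLin hp hq),
    hS.eq_junctionFlux hp hq (by linarith)]

/-- If the profile of `pwLin p q` lies below a piecewise linear function at the junction, then the
flux of the latter is smaller. -/
lemma junctionFlux_le_of_profile_le (hS : JunctionSemigroup Hl Hr Rl Rr ml mr C0 S)
    (hp : p ∈ Icc 0 Rl) (hq : q ∈ Icc 0 Rr) (hp' : p' ∈ Icc 0 Rl) (hq' : q' ∈ Icc 0 Rr)
    (hle : ∀ᶠ y in 𝓝 (0 : ℝ), S 1 (pwLin p q) y ≤ pwLin p' q' y - junctionFlux S p q) :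
    junctionFlux S p' q' ≤ junctionFlux S p q := by
  obtain ⟨h, hh, hcone⟩ := hS.exists_step hle
  have := hS.comparison _ _ (hS.profile_lipClass hp hq) (lipClass_pwLin hp' hq') h 0
    (-junctionFlux S p q) hh.le fun y hy => by linarith [hcone y hy]
  rw [hS.step_junctionFlux hp hq hh, hS.eq_junctionFlux hp' hq' hh] at this
  exact le_of_mul_le_mul_left (by linarith) hh

/-- If the profile of `pwLin p q` lies above a piecewise linear function at the junction, then the
flux of the latter is larger. -/
lemma le_junctionFlux_of_le_profile (hS : JunctionSemigroup Hl Hr Rl Rr ml mr C0 S)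
    (hp : p ∈ Icc 0 Rl) (hq : q ∈ Icc 0 Rr) (hp' : p' ∈ Icc 0 Rl) (hq' : q' ∈ Icc 0 Rr)
    (hle : ∀ᶠ y in 𝓝 (0 : ℝ), pwLin p' q' y - junctionFlux S p q ≤ S 1 (pwLin p q) y) :
    junctionFlux S p q ≤ junctionFlux S p' q' := by
  obtain ⟨h, hh, hcone⟩ := hS.exists_step hle
  have := hS.comparison _ _ (lipClass_pwLin hp' hq') (hS.profile_lipClass hp hq) h 0
    (junctionFlux S p q) hh.le fun y hy => by linarith [hcone y hy]
  rw [hS.step_junctionFlux hp hq hh, hS.eq_junctionFlux hp' hq' hh] at this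
  exact le_of_mul_le_mul_left (by linarith) hh

lemma concaveOn_right (hS : JunctionSemigroup Hl Hr Rl Rr ml mr C0 S) :
    ConcaveOn ℝ (Icc (-Rr) 0) (fun s => Hr (-s)) := by
  refine ⟨convex_Icc _ _, fun x hx y hy a b ha hb hab => ?_⟩
  have := hS.right.concave.2 (⟨by linarith [hx.2], by linarith [hx.1]⟩ : -x ∈ Icc 0 Rr)
    (⟨by linarith [hy.2], by linarith [hy.1]⟩ : -y ∈ Icc 0 Rr) ha hb hab
  simp only [smul_eq_mul] at this ⊢
  rwa [show -(a * x + b * y) = a * -x + b * -y by ring]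

lemma zero_mem_right (hS : JunctionSemigroup Hl Hr Rl Rr ml mr C0 S) : (0 : ℝ) ∈ Icc 0 Rr :=
  ⟨le_rfl, hS.right.mem.1.trans hS.right.mem.2⟩

lemma right_mem_left (hS : JunctionSemigroup Hl Hr Rl Rr ml mr C0 S) : Rl ∈ Icc 0 Rl :=
  ⟨hS.left.mem.1.trans hS.left.mem.2, le_rfl⟩

/-- The flux is maximal unless it is limited by one of the incoming fluxes. -/
lemma le_junctionFlux (hS : JunctionSemigroup Hl Hr Rl Rr ml mr C0 S)
    (hp : p ∈ Icc 0 Rl) (hq : q ∈ Icc 0 Rr) :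
    min (junctionFlux S Rl 0) (min (Hl p) (Hr q)) ≤ junctionFlux S p q := by
  have h0 := hS.zero_mem_right
  have h1 := hS.right_mem_left
  by_contra! hcon
  rw [lt_min_iff, lt_min_iff] at hcon
  obtain ⟨hfA, hfl, hfr⟩ := hcon
  set f := junctionFlux S p q with hf
  have hf0 : 0 ≤ f := hS.junctionFlux_nonneg hp hq
  have hfml : f < Hl ml := hfl.trans_le (hS.left.le_max p hp)
  have hfmr : f < Hr mr := hfr.trans_le (hS.right.le_max q hq)
  obtain ⟨ql, hql, hHql⟩ := hS.left.exists_right hS.left.mem hf0 hfml.le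
  obtain ⟨qr, hqr, hHqr⟩ := hS.right.exists_left hS.right.mem hf0 hfmr.le
  have hql' : ql ∈ Icc 0 Rl := ⟨hS.left.mem.1.trans hql.1, hql.2⟩
  have hqr' : qr ∈ Icc 0 Rr := ⟨hqr.1, hqr.2.trans hS.right.mem.2⟩
  have hle : junctionFlux S ql qr ≤ f := by
    refine hS.junctionFlux_le_of_profile_le hp hq hql' hqr' ?_
    obtain ⟨L, hL, hUL⟩ := hS.exists_far_left hp hq
    obtain ⟨M, hM, hUM⟩ := hS.exists_far_right hp hq
    have hleft := (hS.halfProfile_left hp hq).le_max hS.left.concave hp hql'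
      (hUL.le.trans (le_max_left _ _))
      (le_trans (by rw [hHql, hf, junctionFlux, neg_neg]) (le_max_right _ _))
    have hright := (hS.halfProfile_right hp hq).le_max hS.concaveOn_right (p := -q) (q := -qr)
      (L := M) ⟨by linarith [hq.2], by linarith [hq.1]⟩ ⟨by linarith [hqr'.2], by linarith [hqr'.1]⟩
      (le_trans (by simpa using hUM.le) (le_max_left _ _))
      (le_trans (by simp [hHqr, hf, junctionFlux]) (le_max_right _ _))
    filter_upwards [Ioo_mem_nhds (neg_lt_zero.2 hL) hM,
      eventually_nhds_prodMk_right (eventually_max_affine_eq (p := p) (q := ql) one_pos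
        (Or.inr hfl)),
      eventually_nhds_prodMk_right (eventually_max_affine_eq (p := q) (q := qr) one_pos
        (Or.inr hfr))] with y hy hyl hyr
    simp only [mul_one] at hyl hyr
    rcases le_total y 0 with h | h
    · rw [pwLin_of_nonpos h, ← hyl, ← hHql]
      exact hleft y ⟨hy.1.le, h⟩
    · rw [pwLin_of_nonneg h, ← hyr, ← hHqr]
      simpa using hright (-y) ⟨by linarith [hy.2], by linarith⟩
  have hge : junctionFlux S Rl 0 ≤ junctionFlux S ql qr := by
    refine hS.le_junctionFlux_of_le_profile h1 h0 hql' hqr' ?_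
    have hcl : deriv Hl ql < 0 := by
      have := hS.left.tangent ql hql' ml hS.left.mem
      by_contra! hneg
      nlinarith [hql.1]
    have hcr : -deriv Hr qr < 0 := by
      have := hS.right.tangent qr hqr' mr hS.right.mem
      by_contra! hneg
      nlinarith [hqr.2]
    have hleft := (hS.halfProfile_left h1 h0).boundary_add_le hcl (hS.left.tangent ql hql')
      (hHql.le.trans hfA.le)
    have hright := (hS.halfProfile_right h1 h0).boundary_add_le hcr (hS.tangent_right hqr')
      (by simpa [hHqr, junctionFlux] using hfA.le)
    filter_upwards [Ioo_mem_nhds hcl (neg_lt_zero.1 hcr)] with y hy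
    simp only [junctionFlux, sub_neg_eq_add]
    rcases le_total y 0 with h | h
    · rw [pwLin_of_nonpos h]
      exact hleft y ⟨hy.1.le, h⟩
    · rw [pwLin_of_nonneg h]
      simpa using hright (-y) ⟨by linarith [hy.2], by linarith⟩
  exact absurd (hge.trans hle) (not_le.2 hfA)

/-- The junction flux is the flux-limited one, with limiter the flux of `pwLin Rl 0`. -/
lemma junctionFlux_eq (hS : JunctionSemigroup Hl Hr Rl Rr ml mr C0 S)
    (hp : p ∈ Icc 0 Rl) (hq : q ∈ Icc 0 Rr) :
    junctionFlux S p q = min (junctionFlux S Rl 0) (min (Hplus Hl p) (Hminus Hr Rr q)) := by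
  have h0 := hS.zero_mem_right
  have h1 := hS.right_mem_left
  have hpm : min p ml ∈ Icc 0 Rl := ⟨le_min hp.1 hS.left.mem.1, (min_le_left _ _).trans hp.2⟩
  have hqm : max q mr ∈ Icc 0 Rr := ⟨hq.1.trans (le_max_left _ _), max_le hq.2 hS.right.mem.2⟩
  have hplus : Hplus Hl p = Hl (min p ml) := by
    refine le_antisymm (Hplus_le (hS.left.nonneg hpm) fun y hy => ?_)
      (le_Hplus hS.left.continuous ⟨hpm.1, min_le_left _ _⟩)
    rcases le_total p ml with h | h
    · rw [min_eq_left h]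
      exact hS.left.le_of_le_max hy.1 hy.2 h
    · rw [min_eq_right h]
      exact hS.left.le_max y ⟨hy.1, hy.2.trans hp.2⟩
  have hminus : Hminus Hr Rr q = Hr (max q mr) := by
    refine le_antisymm (Hminus_le (hS.right.nonneg hqm) fun y hy => ?_)
      (le_Hminus hS.right.continuous ⟨le_max_left _ _, hqm.2⟩)
    rcases le_total mr q with h | h
    · rw [max_eq_left h]
      exact hS.right.le_of_max_le h hy.1 hy.2
    · rw [max_eq_right h]
      exact hS.right.le_max y ⟨hq.1.trans hy.1, hy.2⟩
  rw [hplus, hminus]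
  refine le_antisymm (le_min ?_ (le_min ?_ ?_)) ?_
  · exact hS.junctionFlux_mono hp hq h1 h0 hp.2 hq.1
  · rcases le_total p ml with h | h
    · rw [min_eq_left h]
      exact hS.junctionFlux_le_left hp hq h
    · rw [min_eq_right h]
      exact (hS.junctionFlux_le_Amax hp hq).trans hS.Amax_le_left
  · rcases le_total mr q with h | h
    · rw [max_eq_left h]
      exact hS.junctionFlux_le_right hp hq h
    · rw [max_eq_right h]
      exact (hS.junctionFlux_le_Amax hp hq).trans hS.Amax_le_right
  · exact (hS.le_junctionFlux hpm hqm).trans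
      (hS.junctionFlux_mono hpm hqm hp hq (min_le_left _ _) (le_max_left _ _))

end JunctionSemigroup

/-! ### The semigroup solves the flux-limited equation -/

lemma Hplus_mono {H : ℝ → ℝ} (hH : Continuous H) {p q : ℝ} (hpq : p ≤ q) (hq : 0 ≤ Hplus H q) :
    Hplus H p ≤ Hplus H q :=
  Hplus_le hq fun _ hy => le_Hplus hH ⟨hy.1, hy.2.trans hpq⟩

lemma Hminus_anti {H : ℝ → ℝ} (hH : Continuous H) {R p q : ℝ} (hpq : p ≤ q)
    (hp : 0 ≤ Hminus H R p) : Hminus H R q ≤ Hminus H R p :=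
  Hminus_le hp fun _ hy => le_Hminus hH ⟨hpq.trans hy.1, hy.2⟩

namespace JunctionSemigroup

variable {Hl Hr : ℝ → ℝ} {Rl Rr ml mr C0 : ℝ} {S : ℝ → (ℝ → ℝ) → (ℝ → ℝ)}

lemma Hplus_nonneg (hS : JunctionSemigroup Hl Hr Rl Rr ml mr C0 S) {p : ℝ} (hp : 0 ≤ p) :
    0 ≤ Hplus Hl p :=
  hS.left.zero_left.symm.le.trans (le_Hplus hS.left.continuous ⟨le_rfl, hp⟩)

lemma Hminus_nonneg (hS : JunctionSemigroup Hl Hr Rl Rr ml mr C0 S) {q : ℝ} (hq : q ≤ Rr) :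
    0 ≤ Hminus Hr Rr q :=
  hS.right.zero_right.symm.le.trans (le_Hminus hS.right.continuous ⟨hq, le_rfl⟩)

lemma eventually_eq_junctionFlux (hS : JunctionSemigroup Hl Hr Rl Rr ml mr C0 S) {p q : ℝ}
    (hp : p ∈ Icc 0 Rl) (hq : q ∈ Icc 0 Rr) :
    ∀ᶠ h in 𝓝[>] (0 : ℝ), S h (pwLin p q) 0 = pwLin p q 0 - h * junctionFlux S p q := by
  filter_upwards [self_mem_nhdsWithin] with h hh
  rw [hS.eq_junctionFlux hp hq hh, pwLin_zero, zero_sub]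

/-- The subsolution property at the junction. -/
lemma junction_sub (hS : JunctionSemigroup Hl Hr Rl Rr ml mr C0 S) {u0 : ℝ → ℝ}
    (hu0 : LipClass Rl Rr u0) {t : ℝ} (ht : 0 < t) {Φl Φr : ℝ × ℝ → ℝ} {Ll Lr : ℝ × ℝ →L[ℝ] ℝ}
    (hΦl : HasFDerivAt Φl Ll (t, 0)) (hΦr : HasFDerivAt Φr Lr (t, 0))
    (hL : Ll (1, 0) = Lr (1, 0))
    (hl : ∀ᶠ z in 𝓝 (t, (0 : ℝ)), z.2 ≤ 0 → S z.1 u0 z.2 - Φl z ≤ S t u0 0 - Φl (t, 0))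
    (hr : ∀ᶠ z in 𝓝 (t, (0 : ℝ)), 0 ≤ z.2 → S z.1 u0 z.2 - Φr z ≤ S t u0 0 - Φr (t, 0)) :
    Ll (1, 0) + min (junctionFlux S Rl 0)
      (min (Hplus Hl (Ll (0, 1))) (Hminus Hr Rr (Lr (0, 1)))) ≤ 0 := by
  have hRl := hS.right_mem_left.1
  have hRr := hS.zero_mem_right.2
  have hlip := hS.lipClass t u0 ht.le hu0
  have hpl : Ll (0, 1) ≤ Rl := by
    refine hΦl.hasDerivAt_snd.le_of_left ?_
    filter_upwards [nhdsWithin_le_nhds (eventually_nhds_prodMk_right hl), self_mem_nhdsWithin]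
      with y h1 h2
    linarith [h1 (le_of_lt h2), (hlip.1 y 0 (le_of_lt h2) le_rfl).2]
  have hpr : 0 ≤ Lr (0, 1) := by
    refine hΦr.hasDerivAt_snd.ge_of_right ?_
    filter_upwards [nhdsWithin_le_nhds (eventually_nhds_prodMk_right hr), self_mem_nhdsWithin]
      with y h1 h2
    linarith [h1 (le_of_lt h2), (hlip.2 0 y le_rfl (le_of_lt h2)).1]
  have hp : max (Ll (0, 1)) 0 ∈ Icc 0 Rl := ⟨le_max_right _ _, max_le hpl hRl⟩
  have hq : min (Lr (0, 1)) Rr ∈ Icc 0 Rr := ⟨le_min hpr hRr, min_le_right _ _⟩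
  have key : Ll (1, 0) + junctionFlux S (max (Ll (0, 1)) 0) (min (Lr (0, 1)) Rr) ≤ 0 := by
    refine hS.step_sub hu0 (lipClass_pwLin hp hq) ht (hS.eventually_eq_junctionFlux hp hq)
      fun ε hε => ?_
    have hlt : ∀ᶠ h in 𝓝[>] (0 : ℝ), h < t := nhdsWithin_le_nhds (Iio_mem_nhds ht)
    filter_upwards [hΦl.eventually_cone hS.speed_pos hε, hΦr.eventually_cone hS.speed_pos hε,
      eventually_cone hS.speed_pos hl, eventually_cone hS.speed_pos hr, hlt,
      self_mem_nhdsWithin] with h h1 h2 h3 h4 hlt hpos y hy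
    have hu := hS.lipClass (t - h) u0 (by linarith) hu0
    have hpos : 0 < h := hpos
    have hy0 : |(0 : ℝ) - 0| ≤ C0 * h := by
      simpa using mul_nonneg hS.speed_pos.le hpos.le
    have hzero : S (t - h) u0 0 ≤ S t u0 0 - Ll (1, 0) * h + ε * h := by
      linarith [(abs_le.1 (h1 0 hy0)).2, h3 0 hy0 le_rfl]
    rcases le_total y 0 with hy' | hy'
    · rw [pwLin_of_nonpos hy', pwLin_zero]
      rcases max_cases (Ll (0, 1)) 0 with ⟨e, -⟩ | ⟨e, -⟩ <;> rw [e]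
      · linarith [(abs_le.1 (h1 y hy)).2, h3 y hy hy']
      · linarith [hu.monotone hy']
    · rw [pwLin_of_nonneg hy', pwLin_zero]
      rcases min_cases (Lr (0, 1)) Rr with ⟨e, -⟩ | ⟨e, -⟩ <;> rw [e]
      · rw [hL]
        linarith [(abs_le.1 (h2 y hy)).2, h4 y hy hy']
      · linarith [(hu.2 0 y le_rfl hy').2]
  rw [hS.junctionFlux_eq hp hq] at key
  refine le_trans ?_ key
  gcongr
  · exact Hplus_mono hS.left.continuous (le_max_left _ _) (hS.Hplus_nonneg hp.1)
  · exact Hminus_anti hS.right.continuous (min_le_left _ _) (hS.Hminus_nonneg hq.2)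

/-- The supersolution property at the junction. -/
lemma junction_super (hS : JunctionSemigroup Hl Hr Rl Rr ml mr C0 S) {u0 : ℝ → ℝ}
    (hu0 : LipClass Rl Rr u0) {t : ℝ} (ht : 0 < t) {Φl Φr : ℝ × ℝ → ℝ} {Ll Lr : ℝ × ℝ →L[ℝ] ℝ}
    (hΦl : HasFDerivAt Φl Ll (t, 0)) (hΦr : HasFDerivAt Φr Lr (t, 0))
    (hL : Ll (1, 0) = Lr (1, 0))
    (hl : ∀ᶠ z in 𝓝 (t, (0 : ℝ)), z.2 ≤ 0 → S t u0 0 - Φl (t, 0) ≤ S z.1 u0 z.2 - Φl z)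
    (hr : ∀ᶠ z in 𝓝 (t, (0 : ℝ)), 0 ≤ z.2 → S t u0 0 - Φr (t, 0) ≤ S z.1 u0 z.2 - Φr z) :
    0 ≤ Ll (1, 0) + min (junctionFlux S Rl 0)
      (min (Hplus Hl (Ll (0, 1))) (Hminus Hr Rr (Lr (0, 1)))) := by
  have hRl := hS.right_mem_left.1
  have hRr := hS.zero_mem_right.2
  have hlip := hS.lipClass t u0 ht.le hu0
  have hpl : 0 ≤ Ll (0, 1) := by
    refine hΦl.hasDerivAt_snd.ge_of_left ?_
    filter_upwards [nhdsWithin_le_nhds (eventually_nhds_prodMk_right hl), self_mem_nhdsWithin]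
      with y h1 h2
    linarith [h1 (le_of_lt h2), (hlip.1 y 0 (le_of_lt h2) le_rfl).1]
  have hpr : Lr (0, 1) ≤ Rr := by
    refine hΦr.hasDerivAt_snd.le_of_right ?_
    filter_upwards [nhdsWithin_le_nhds (eventually_nhds_prodMk_right hr), self_mem_nhdsWithin]
      with y h1 h2
    linarith [h1 (le_of_lt h2), (hlip.2 0 y le_rfl (le_of_lt h2)).2]
  have hp : min (Ll (0, 1)) Rl ∈ Icc 0 Rl := ⟨le_min hpl hRl, min_le_right _ _⟩
  have hq : max (Lr (0, 1)) 0 ∈ Icc 0 Rr := ⟨le_max_right _ _, max_le hpr hRr⟩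
  have key : 0 ≤ Ll (1, 0) + junctionFlux S (min (Ll (0, 1)) Rl) (max (Lr (0, 1)) 0) := by
    refine hS.step_super hu0 (lipClass_pwLin hp hq) ht (hS.eventually_eq_junctionFlux hp hq)
      fun ε hε => ?_
    have hlt : ∀ᶠ h in 𝓝[>] (0 : ℝ), h < t := nhdsWithin_le_nhds (Iio_mem_nhds ht)
    filter_upwards [hΦl.eventually_cone hS.speed_pos hε, hΦr.eventually_cone hS.speed_pos hε,
      eventually_cone hS.speed_pos hl, eventually_cone hS.speed_pos hr, hlt,
      self_mem_nhdsWithin] with h h1 h2 h3 h4 hlt hpos y hy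
    have hu := hS.lipClass (t - h) u0 (by linarith) hu0
    have hpos : 0 < h := hpos
    have hy0 : |(0 : ℝ) - 0| ≤ C0 * h := by
      simpa using mul_nonneg hS.speed_pos.le hpos.le
    have hzero : S t u0 0 - Ll (1, 0) * h - ε * h ≤ S (t - h) u0 0 := by
      linarith [(abs_le.1 (h1 0 hy0)).1, h3 0 hy0 le_rfl]
    rcases le_total y 0 with hy' | hy'
    · rw [pwLin_of_nonpos hy', pwLin_zero]
      rcases min_cases (Ll (0, 1)) Rl with ⟨e, -⟩ | ⟨e, -⟩ <;> rw [e]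
      · linarith [(abs_le.1 (h1 y hy)).1, h3 y hy hy']
      · linarith [(hu.1 y 0 hy' le_rfl).2]
    · rw [pwLin_of_nonneg hy', pwLin_zero]
      rcases max_cases (Lr (0, 1)) 0 with ⟨e, -⟩ | ⟨e, -⟩ <;> rw [e]
      · rw [hL]
        linarith [(abs_le.1 (h2 y hy)).1, h4 y hy hy']
      · linarith [hu.monotone hy']
  rw [hS.junctionFlux_eq hp hq] at key
  refine key.trans ?_
  gcongr
  · exact Hplus_mono hS.left.continuous (min_le_left _ _) (hS.Hplus_nonneg hpl)
  · exact Hminus_anti hS.right.continuous (le_max_left _ _) (hS.Hminus_nonneg hpr)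

/-- A time-continuous junction semigroup solves the flux-limited equation. -/
lemma flSol (hS : JunctionSemigroup Hl Hr Rl Rr ml mr C0 S) {u0 : ℝ → ℝ}
    (hu0 : LipClass Rl Rr u0)
    (hcont : ContinuousOn (fun z : ℝ × ℝ => S z.1 u0 z.2) domHJ) (hinit : S 0 u0 = u0) :
    FLSol Hl Hr Rl Rr (junctionFlux S Rl 0) u0 (fun t x => S t u0 x) :=
  FLSol.of_touch hcont (fun t ht => hS.lipClass t u0 ht hu0) (fun x => congrFun hinit x)
    (fun _ _ ht hx _ _ hΦ h =>
      ((hS.locallyLinear_left hx).touch_sub hS.toLocalSemigroup hu0 ht hΦ h).2)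
    (fun _ _ ht hx _ _ hΦ h =>
      ((hS.locallyLinear_left hx).touch_super hS.toLocalSemigroup hu0 ht hΦ h).2)
    (fun _ _ ht hx _ _ hΦ h =>
      ((hS.locallyLinear_right hx).touch_sub hS.toLocalSemigroup hu0 ht hΦ h).2)
    (fun _ _ ht hx _ _ hΦ h =>
      ((hS.locallyLinear_right hx).touch_super hS.toLocalSemigroup hu0 ht hΦ h).2)
    (fun _ ht _ _ _ _ hΦl hΦr hL hl hr => hS.junction_sub hu0 ht hΦl hΦr hL hl hr)
    (fun _ ht _ _ _ _ hΦl hΦr hL hl hr => hS.junction_super hu0 ht hΦl hΦr hL hl hr)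

end JunctionSemigroup

/-- A family of functions of `Lip` that is locally uniformly continuous in time is jointly
continuous. -/
lemma LipClass.continuousOn_domHJ {Rl Rr : ℝ} {u : ℝ → ℝ → ℝ}
    (hu : ∀ t, 0 ≤ t → LipClass Rl Rr (u t))
    (hlim : ∀ (tn : ℕ → ℝ) (t : ℝ), (∀ n, 0 ≤ tn n) → 0 ≤ t → Tendsto tn atTop (𝓝 t) →
      TendstoLocallyUniformly (fun n => u (tn n)) (u t) atTop) :
    ContinuousOn (fun z : ℝ × ℝ => u z.1 z.2) domHJ := by
  rw [continuousOn_iff_continuous_domRestrict, continuous_iff_seqContinuous]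
  intro zn z hz
  have hval := (continuous_subtype_val.tendsto z).comp hz
  exact (hlim (fun n => (zn n).1.1) z.1.1 (fun n => (zn n).2.1) z.2.1
    ((continuous_fst.tendsto _).comp hval)).tendsto_comp
    (hu _ z.2.1).continuous.continuousAt ((continuous_snd.tendsto _).comp hval)

/-- any continuous, `L^∞`-contractive semi-group on `Lip` satisfying the
natural conditions (H1)–(H6) is given by a flux-limited solution of the HJ equation. -/
theorem hj_semigroup_identification
    (Hl Hr : ℝ → ℝ) (Rl Rr : ℝ) (hRl : 0 < Rl) (hRr : 0 < Rr)
    (hHl : ContDiff ℝ 1 Hl) (hHlc : StrictConcaveOn ℝ (Icc 0 Rl) Hl)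
    (hHl0 : Hl 0 = 0) (hHlR : Hl Rl = 0)
    (hHr : ContDiff ℝ 1 Hr) (hHrc : StrictConcaveOn ℝ (Icc 0 Rr) Hr)
    (hHr0 : Hr 0 = 0) (hHrR : Hr Rr = 0)
    (S : ℝ → (ℝ → ℝ) → (ℝ → ℝ))
    (hSmap : ∀ t u0, 0 ≤ t → LipClass Rl Rr u0 → LipClass Rl Rr (S t u0))
    -- (H1) : continuous homogeneous semi-group
    (hH1a : ∀ u0, LipClass Rl Rr u0 → S 0 u0 = u0)
    (hH1b : ∀ s t : ℝ, 0 ≤ s → 0 ≤ t → ∀ u0, LipClass Rl Rr u0 →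
      S (t + s) u0 = S t (S s u0))
    (hH1c : ∀ (tn : ℕ → ℝ) (t : ℝ) (un : ℕ → ℝ → ℝ) (u0 : ℝ → ℝ),
      (∀ n, 0 ≤ tn n) → 0 ≤ t → (∀ n, LipClass Rl Rr (un n)) → LipClass Rl Rr u0 →
      Tendsto tn atTop (𝓝 t) → TendstoLocallyUniformly un u0 atTop →
      TendstoLocallyUniformly (fun n => S (tn n) (un n)) (S t u0) atTop)
    -- (H2) : L^∞-contraction on bounded data
    (hH2 : ∀ u1 u2 : ℝ → ℝ, LipClass Rl Rr u1 → LipClass Rl Rr u2 →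
      (∃ C, ∀ x, |u1 x| ≤ C) → (∃ C, ∀ x, |u2 x| ≤ C) →
      ∀ t, 0 ≤ t → ∀ C : ℝ, (∀ x, |u1 x - u2 x| ≤ C) → ∀ x, |S t u1 x - S t u2 x| ≤ C)
    -- (H3) : commutation with constants
    (hH3 : ∀ t, 0 ≤ t → ∀ u0, LipClass Rl Rr u0 → ∀ c x : ℝ,
      S t (fun y => u0 y + c) x = S t u0 x + c)
    (C0 : ℝ) (hC0 : 0 < C0)
    -- (H4) : finite speed of propagation
    (hH4 : ∀ u1 u2 : ℝ → ℝ, LipClass Rl Rr u1 → LipClass Rl Rr u2 → ∀ a b : ℝ,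
      (∀ x ∈ Icc a b, u1 x = u2 x) → ∀ t : ℝ, 0 ≤ t → t ≤ C0⁻¹ * (b - a) →
      ∀ x ∈ Icc (a + C0 * t) (b - C0 * t), S t u1 x = S t u2 x)
    -- (H5) : local coincidence with the minimal semi-group away from x = 0
    (hH5 : ∀ u0, LipClass Rl Rr u0 → ∀ ubar : ℝ → ℝ → ℝ,
      FLSol Hl Hr Rl Rr (Amax Hl Hr Rl Rr) u0 ubar →
      ∀ x : ℝ, x ≠ 0 → ∀ t : ℝ, 0 < t → t < C0⁻¹ * |x| →
      ∀ y : ℝ, |y - x| < |x| - C0 * t → S t u0 y = ubar t y)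
    -- (H6) : scale invariance
    (hH6 : ∀ ε t : ℝ, 0 < ε → 0 < t → ∀ u0, LipClass Rl Rr u0 → ∀ x : ℝ,
      ε * S (t / ε) (fun y => ε * u0 (y / ε)) (x / ε) = S t u0 x) :
    ∃ Abar ∈ Icc (0 : ℝ) (Amax Hl Hr Rl Rr),
      ∀ u0, LipClass Rl Rr u0 →
        FLSol Hl Hr Rl Rr Abar u0 (fun t x => S t u0 x) := by
  obtain ⟨ml, hml⟩ := exists_bell hRl.le hHl hHlc.concaveOn hHl0 hHlR
  obtain ⟨mr, hmr⟩ := exists_bell hRr.le hHr hHrc.concaveOn hHr0 hHrR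
  have hS : JunctionSemigroup Hl Hr Rl Rr ml mr C0 S :=
    { speed_pos := hC0
      lipClass := hSmap
      semigroup := hH1b
      comparison := fun u v hu hv t x c ht huv =>
        local_comparison hRl.le hRr.le hH2 hH3 hC0 hH4 hu hv ht huv
      scaling := hH6
      left := hml
      right := hmr
      eq_off := fun u0 hu0 ubar hubar x hx t ht htx => by
        refine hH5 u0 hu0 ubar hubar x hx t ht htx x ?_
        rw [← div_eq_inv_mul, lt_div_iff₀ hC0] at htx
        rw [sub_self, abs_zero]
        linarith }
  have hp := hS.right_mem_left
  have hq := hS.zero_mem_right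
  refine ⟨junctionFlux S Rl 0, ⟨hS.junctionFlux_nonneg hp hq, hS.junctionFlux_le_Amax hp hq⟩,
    fun u0 hu0 => hS.flSol hu0 ?_ (hH1a u0 hu0)⟩
  refine LipClass.continuousOn_domHJ (fun t ht => hSmap t u0 ht hu0) fun tn t htn ht hlim => ?_
  refine hH1c tn t (fun _ => u0) u0 htn ht (fun _ => hu0) hu0 hlim ?_
  exact fun v hv x => ⟨univ, univ_mem, Eventually.of_forall fun _ y _ => refl_mem_uniformity hv⟩
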